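/- arXiv:2008.03052 — 14 statements merged into one kernel-verified Lean document; each statement's English description precedes it below -/
import Mathlib

section
/- Let H > 0 and let R : [0,∞)² → ℝ be symmetric, positive definite, satisfy the self-similarity scaling R(a·s, a·t) = a^{2H}·R(s,t) for all a > 0 and s,t ≥ 0, and satisfy Doob's Markov criterion R(s,u)·R(t,t) = R(s,t)·R(t,u) for all 0 ≤ s ≤ t ≤ u. Then R(1,1) ≥ 0, R(s,t) = 0 whenever min(s,t) = 0, and either R(s,t) = 0 for all s ≠ t, or there exists a real number c ≤ −H such that R(s,t) = R(1,1)·(max(s,t))^{2H+c}·(min(s,t))^{−c} for all s,t > 0. -/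
open Real

/-- An additive function on `[0, ∞)` which is nonpositive is linear. -/
theorem eq_mul_of_add_of_nonpos (k : ℝ → ℝ)
    (hadd : ∀ u v : ℝ, 0 ≤ u → 0 ≤ v → k (u + v) = k u + k v)
    (hneg : ∀ u : ℝ, 0 ≤ u → k u ≤ 0) (u : ℝ) (hu : 0 ≤ u) : k u = u * k 1 := by
  have h0 : k 0 = 0 := by
    have := hadd 0 0 le_rfl le_rfl
    simp only [add_zero] at this
    linarith
  have hmul : ∀ (n : ℕ) (v : ℝ), 0 ≤ v → k (n * v) = n * k v := by
    intro n v hv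
    induction n with
    | zero => simp [h0]
    | succ n ih =>
      push_cast
      rw [add_mul, one_mul, hadd _ _ (by positivity) hv, ih]
      ring
  have hanti : ∀ u v : ℝ, 0 ≤ u → u ≤ v → k v ≤ k u := by
    intro u v hu huv
    have h := hadd u (v - u) hu (by linarith)
    rw [add_sub_cancel] at h
    linarith [hneg (v - u) (by linarith)]
  have hk1 : k 1 ≤ 0 := hneg 1 zero_le_one
  have hbound : ∀ n : ℕ, n * |k u - u * k 1| ≤ -k 1 := by
    intro n
    have hnu : 0 ≤ n * u := by positivity
    have h1 : (⌊n * u⌋₊ : ℝ) ≤ n * u := Nat.floor_le hnu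
    have h2 : n * u ≤ ⌊n * u⌋₊ + 1 := (Nat.lt_floor_add_one _).le
    have h3 := hanti _ _ (Nat.cast_nonneg _) h1
    have h4 := hanti _ _ hnu h2
    have h5 := hmul ⌊n * u⌋₊ 1 zero_le_one
    rw [mul_one] at h5
    rw [hadd _ _ (Nat.cast_nonneg _) zero_le_one] at h4
    rw [hmul n u hu] at h3 h4
    rw [h5] at h3 h4
    have h6 := mul_le_mul_of_nonpos_right h1 hk1
    have h7 := mul_le_mul_of_nonpos_right h2 hk1
    rw [← Nat.abs_cast n, ← abs_mul, abs_le]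
    constructor <;> linarith
  by_contra hne
  have hpos : 0 < |k u - u * k 1| := abs_pos.mpr (sub_ne_zero.mpr hne)
  obtain ⟨n, hn⟩ := exists_nat_gt (-k 1 / |k u - u * k 1|)
  rw [div_lt_iff₀ hpos] at hn
  linarith [hbound n]

/-- A multiplicative function on the additive half-line `[0, ∞)` which is dominated by an
exponential either vanishes on `(0, ∞)` or is an exponential. -/
theorem eq_zero_or_eq_exp_of_map_add (H : ℝ) (F : ℝ → ℝ)
    (hadd : ∀ u v : ℝ, 0 ≤ u → 0 ≤ v → F (u + v) = F u * F v)
    (hF0 : F 0 = 1) (hle : ∀ u : ℝ, 0 ≤ u → F u ≤ exp (H * u)) :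
    (∀ u : ℝ, 0 < u → F u = 0) ∨ ∃ b : ℝ, b ≤ H ∧ ∀ u : ℝ, 0 ≤ u → F u = exp (b * u) := by
  by_cases hz : ∃ u, 0 ≤ u ∧ F u = 0
  · left
    obtain ⟨w, hw, hFw⟩ := hz
    intro v hv
    have hpow : ∀ n : ℕ, F (n * v) = F v ^ n := by
      intro n
      induction n with
      | zero => simp [hF0]
      | succ n ih =>
        push_cast
        rw [add_mul, one_mul, hadd _ _ (by positivity) hv.le, ih, pow_succ]
    obtain ⟨n, hn⟩ := exists_nat_gt (w / v)
    rw [div_lt_iff₀ hv] at hn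
    have h := hadd w (n * v - w) hw (by linarith)
    rw [add_sub_cancel, hFw, zero_mul, hpow] at h
    exact eq_zero_of_pow_eq_zero h
  · right
    push Not at hz
    have hpos : ∀ u, 0 ≤ u → 0 < F u := by
      intro u hu
      have h := hadd (u / 2) (u / 2) (by linarith) (by linarith)
      rw [add_halves] at h
      rw [h]
      exact mul_self_pos.mpr (hz _ (by linarith))
    have hlog : ∀ u, 0 ≤ u → log (F u) - H * u ≤ 0 := by
      intro u hu
      have h := log_le_log (hpos u hu) (hle u hu)
      rw [log_exp] at h
      linarith
    have hlin := eq_mul_of_add_of_nonpos (fun u => log (F u) - H * u)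
      (fun u v hu hv => by
        simp only [hadd u v hu hv, log_mul (hpos u hu).ne' (hpos v hv).ne']
        ring)
      hlog
    refine ⟨log (F 1), by linarith [hlog 1 zero_le_one], fun u hu => ?_⟩
    have h := hlin u hu
    rw [← exp_log (hpos u hu)]
    congr 1
    linarith

/-- Main theorem: any symmetric, positive definite, `H`-self-similar covariance
satisfying Doob's Markov criterion is, up to the constant `R 1 1`, either the
white-noise-type kernel or `R_{H,c}` for some `c ≤ -H`. -/
theorem selfSimilar_gaussian_markov_covariance
    (H : ℝ) (hH : 0 < H) (R : ℝ → ℝ → ℝ)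
    (hsymm : ∀ s t : ℝ, 0 ≤ s → 0 ≤ t → R s t = R t s)
    (hposdef : ∀ (d : ℕ), 1 ≤ d → ∀ (t : Fin d → ℝ) (a : Fin d → ℝ),
      (∀ i, 0 ≤ t i) → 0 ≤ ∑ k : Fin d, ∑ l : Fin d, a k * a l * R (t k) (t l))
    (hscal : ∀ a : ℝ, 0 < a → ∀ s t : ℝ, 0 ≤ s → 0 ≤ t →
      R (a * s) (a * t) = a ^ (2 * H) * R s t)
    (hmarkov : ∀ s t u : ℝ, 0 ≤ s → s ≤ t → t ≤ u →
      R s u * R t t = R s t * R t u) :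
    0 ≤ R 1 1 ∧
    (∀ s t : ℝ, 0 ≤ s → 0 ≤ t → min s t = 0 → R s t = 0) ∧
    ((∀ s t : ℝ, 0 ≤ s → 0 ≤ t → s ≠ t → R s t = 0) ∨
      ∃ c : ℝ, c ≤ -H ∧ ∀ s t : ℝ, 0 < s → 0 < t →
        R s t = R 1 1 * (max s t) ^ (2 * H + c) * (min s t) ^ (-c)) := by
  have hdiag : ∀ t : ℝ, 0 ≤ t → 0 ≤ R t t := by
    intro t ht
    simpa using hposdef 1 le_rfl (fun _ => t) (fun _ => 1) (fun _ => ht)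
  have hcs : ∀ s t : ℝ, 0 ≤ s → 0 ≤ t → R s t ^ 2 ≤ R s s * R t t := by
    intro s t hs ht
    have hd : discrim (R s s) (2 * R s t) (R t t) ≤ 0 := by
      refine discrim_le_zero fun x => ?_
      have h := hposdef 2 one_le_two ![s, t] ![x, 1]
        (by intro i; fin_cases i <;> simp [hs, ht])
      simp only [Fin.sum_univ_two, Matrix.cons_val_zero, Matrix.cons_val_one] at h
      rw [hsymm t s ht hs] at h
      linarith
    unfold discrim at hd
    linarith
  have h00 : R 0 0 = 0 := by
    have h := hscal 2 two_pos 0 0 le_rfl le_rfl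
    rw [mul_zero] at h
    have h2 : (1 : ℝ) < 2 ^ (2 * H) := one_lt_rpow one_lt_two (by linarith)
    have h3 : ((2 : ℝ) ^ (2 * H) - 1) * R 0 0 = 0 := by linarith
    exact (mul_eq_zero.mp h3).resolve_left (by linarith)
  have hzero : ∀ s t : ℝ, 0 ≤ s → 0 ≤ t → R s s * R t t = 0 → R s t = 0 := by
    intro s t hs ht h
    have h2 := hcs s t hs ht
    rw [h] at h2
    exact pow_eq_zero_iff two_ne_zero |>.mp (le_antisymm h2 (sq_nonneg _))
  have hmin : ∀ s t : ℝ, 0 ≤ s → 0 ≤ t → min s t = 0 → R s t = 0 := by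
    intro s t hs ht h
    refine hzero s t hs ht ?_
    rcases min_choice s t with h' | h' <;> rw [h] at h' <;> subst h' <;> simp [h00]
  refine ⟨hdiag 1 zero_le_one, hmin, ?_⟩
  have hscal_diag : ∀ t : ℝ, 0 < t → R t t = t ^ (2 * H) * R 1 1 := by
    intro t ht
    simpa using hscal t ht 1 1 zero_le_one zero_le_one
  have hscal_ratio : ∀ s t : ℝ, 0 < s → 0 < t → R s t = s ^ (2 * H) * R 1 (t / s) := by
    intro s t hs ht
    have h := hscal s hs 1 (t / s) zero_le_one (by positivity)
    rwa [mul_one, mul_div_cancel₀ _ hs.ne'] at h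
  have hoff : (∀ s t : ℝ, 0 < s → s < t → R s t = 0) →
      ∀ s t : ℝ, 0 ≤ s → 0 ≤ t → s ≠ t → R s t = 0 := by
    intro h s t hs ht hst
    rcases hs.eq_or_lt with rfl | hs'
    · exact hmin _ _ le_rfl ht (min_eq_left ht)
    rcases ht.eq_or_lt with rfl | ht'
    · exact hmin _ _ hs le_rfl (min_eq_right hs)
    rcases hst.lt_or_gt with hlt | hlt
    · exact h s t hs' hlt
    · rw [hsymm s t hs ht]
      exact h t s ht' hlt
  rcases (hdiag 1 zero_le_one).eq_or_lt with h11 | h11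
  · refine Or.inl (hoff fun s t hs hst => hzero s t hs.le (hs.trans hst).le ?_)
    rw [hscal_diag s hs, ← h11]
    simp
  have hmul : ∀ u v : ℝ, 0 ≤ u → 0 ≤ v →
      R 1 (exp (u + v)) / R 1 1 = R 1 (exp u) / R 1 1 * (R 1 (exp v) / R 1 1) := by
    intro u v hu hv
    have h := hmarkov 1 (exp u) (exp (u + v)) zero_le_one (one_le_exp hu)
      (exp_le_exp.mpr (by linarith))
    rw [hscal_diag _ (exp_pos u), hscal_ratio (exp u) _ (exp_pos u) (exp_pos _), ← exp_sub,
      add_sub_cancel_left] at h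
    have hp : 0 < exp u ^ (2 * H) := rpow_pos_of_pos (exp_pos u) _
    have h' : R 1 (exp (u + v)) * R 1 1 = R 1 (exp u) * R 1 (exp v) :=
      mul_left_cancel₀ hp.ne' (by linarith)
    field_simp
    linarith
  have hle : ∀ u : ℝ, 0 ≤ u → R 1 (exp u) / R 1 1 ≤ exp (H * u) := by
    intro u _
    rw [div_le_iff₀ h11]
    refine (abs_le_of_sq_le_sq' ?_ (by positivity)).2
    have h := hcs 1 (exp u) zero_le_one (exp_pos u).le
    rw [hscal_diag _ (exp_pos u), ← exp_mul] at h
    have he : exp (u * (2 * H)) = exp (H * u) ^ 2 := by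
      rw [← exp_nat_mul]
      congr 1
      push_cast
      ring
    rw [he] at h
    linarith
  rcases eq_zero_or_eq_exp_of_map_add H (fun u => R 1 (exp u) / R 1 1) hmul
    (by simp [h11.ne']) hle with hvanish | ⟨b, hb, hexp⟩
  · refine Or.inl (hoff fun s t hs hst => ?_)
    have hts : 1 < t / s := (one_lt_div hs).mpr hst
    have h := hvanish (log (t / s)) (log_pos hts)
    simp only [exp_log (zero_lt_one.trans hts)] at h
    rw [hscal_ratio s t hs (hs.trans hst), (div_eq_zero_iff.mp h).resolve_right h11.ne', mul_zero]
  · have hform : ∀ s t : ℝ, 0 < s → s ≤ t → R s t = R 1 1 * t ^ b * s ^ (2 * H - b) := by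
      intro s t hs hst
      have ht : 0 < t := hs.trans_le hst
      have hts : 1 ≤ t / s := (one_le_div hs).mpr hst
      have h := hexp (log (t / s)) (log_nonneg hts)
      simp only [exp_log (zero_lt_one.trans_le hts)] at h
      rw [mul_comm b, ← rpow_def_of_pos (zero_lt_one.trans_le hts), div_rpow ht.le hs.le,
        div_eq_iff h11.ne'] at h
      rw [hscal_ratio s t hs ht, h, rpow_sub hs]
      ring
    refine Or.inr ⟨b - 2 * H, by linarith, fun s t hs ht => ?_⟩
    rw [add_sub_cancel, neg_sub]
    rcases le_total s t with hst | hst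
    · rw [max_eq_right hst, min_eq_left hst]
      exact hform s t hs hst
    · rw [max_eq_left hst, min_eq_right hst, hsymm s t hs.le ht.le]
      exact hform t s ht hst
end

section
/- (Ostrowski) Suppose f : ℝ → ℝ satisfies Cauchy's functional equation f(x+y) = f(x) + f(y) for all real x, y. Then either there exists a constant c with f(x) = c·x for all x, or for every Lebesgue-measurable set S ⊆ ℝ of positive Lebesgue measure, f is unbounded above and unbounded below on S (i.e., sup_{x∈S} f(x) = +∞ and inf_{x∈S} f(x) = −∞). -/
open MeasureTheory

/-- A measurable set of positive measure meets one of its reflections `c - S` in a set of positive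
measure. -/
theorem exists_measure_inter_sub_pos {G : Type*} [AddGroup G] [MeasurableSpace G]
    [MeasurableAdd₂ G] [MeasurableNeg G] (μ : Measure G) [SFinite μ] [μ.IsAddRightInvariant]
    {S : Set G} (hS : MeasurableSet S) (hpos : 0 < μ S) :
    ∃ c : G, 0 < μ (S ∩ {x | c - x ∈ S}) := by
  by_contra! h
  have hP : MeasurableSet {p : G × G | p.2 ∈ S ∧ p.1 - p.2 ∈ S} :=
    (measurable_snd hS).inter ((measurable_fst.sub measurable_snd) hS)
  have hnull : μ.prod μ {p : G × G | p.2 ∈ S ∧ p.1 - p.2 ∈ S} = 0 :=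
    (Measure.measure_prod_null hP).2 <| .of_forall fun c => nonpos_iff_eq_zero.1 (h c)
  have hpre : (fun z : G × G => (z.1 + z.2, z.2)) ⁻¹' {p : G × G | p.2 ∈ S ∧ p.1 - p.2 ∈ S}
      = S ×ˢ S := by
    ext ⟨x, y⟩
    simp [and_comm]
  rw [← (measurePreserving_add_prod μ μ).measure_preimage hP.nullMeasurableSet, hpre,
    Measure.prod_prod, mul_self_eq_zero] at hnull
  exact hpos.ne' hnull

/-- An additive map to `ℝ` that is bounded above on a measurable set of positive Haar measure is
continuous. -/
theorem AddMonoidHom.continuous_of_bddAbove_image {E : Type*} [SeminormedAddCommGroup E]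
    [LocallyCompactSpace E] [SecondCountableTopology E] [MeasurableSpace E] [BorelSpace E]
    (μ : Measure E) [μ.IsAddHaarMeasure] [μ.InnerRegular] (f : E →+ ℝ) {S : Set E}
    (hS : MeasurableSet S) (hpos : 0 < μ S) (hbdd : BddAbove (f '' S)) : Continuous f := by
  obtain ⟨M, hM⟩ := hbdd
  have hM' : ∀ x ∈ S, f x ≤ M := fun x hx => hM ⟨x, hx, rfl⟩
  obtain ⟨c, hc⟩ := exists_measure_inter_sub_pos μ hS hpos
  have hT : MeasurableSet (S ∩ {x | c - x ∈ S}) := hS.inter ((measurable_id.const_sub c) hS)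
  refine f.continuous_of_isBounded_nhds_zero (Measure.sub_mem_nhds_zero_of_addHaar_pos μ _ hT hc) ?_
  refine (Metric.isBounded_Icc (f c - 2 * M) (2 * M - f c)).subset ?_
  rintro _ ⟨_, ⟨x, ⟨hx, hcx⟩, y, ⟨hy, hcy⟩, rfl⟩, rfl⟩
  have h₁ := hM' _ hcx
  have h₂ := hM' _ hcy
  have h₃ := hM' _ hx
  have h₄ := hM' _ hy
  simp only [map_sub, Set.mem_Icc] at *
  constructor <;> linarith

/-- Ostrowski's theorem: an additive function `f : ℝ → ℝ` is either linear or
unbounded above and below on every set of positive Lebesgue measure. -/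
theorem ostrowski (f : ℝ → ℝ) (hf : ∀ x y : ℝ, f (x + y) = f x + f y) :
    (∃ c : ℝ, ∀ x : ℝ, f x = c * x) ∨
    (∀ S : Set ℝ, MeasurableSet S → 0 < volume S →
      ¬ BddAbove (f '' S) ∧ ¬ BddBelow (f '' S)) := by
  let F : ℝ →+ ℝ := AddMonoidHom.mk' f hf
  by_cases hF : Continuous F
  · refine .inl ⟨f 1, fun x => ?_⟩
    simpa [F, mul_comm] using map_real_smul F hF x 1
  refine .inr fun S hS hpos => ⟨fun h => hF ?_, fun h => hF ?_⟩
  · exact F.continuous_of_bddAbove_image volume hS hpos h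
  · have hneg : BddAbove ((-F) '' S) := by
      obtain ⟨m, hm⟩ := h
      refine ⟨-m, ?_⟩
      rintro _ ⟨x, hx, rfl⟩
      exact neg_le_neg (hm ⟨x, hx, rfl⟩)
    have hcont := ((-F).continuous_of_bddAbove_image volume hS hpos hneg).neg
    exact hcont.congr fun x => neg_neg (F x)
end

section
/- (Lindström, chain case) Let d ≥ 1, let x₁ ≤ x₂ ≤ … ≤ x_d be real numbers, and let f₁,…,f_d : ℝ → ℝ. Then the d×d determinant det( f_i(min(x_i, x_j)) )_{i,j=1,…,d} equals f₁(x₁) · ∏_{i=2}^{d} ( f_i(x_i) − f_i(x_{i−1}) ). -/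
open Finset

/-- Lindström's determinant identity for a chain: for `x₀ ≤ x₁ ≤ … ≤ x_d` and functions
`f₀, …, f_d`, the determinant of the matrix with entries `f_i (min (x i) (x j))` equals
`f₀(x₀) · ∏_{i=1}^{d} (f_i(x_i) − f_i(x_{i−1}))`. -/
theorem lindstrom_chain_det (d : ℕ) (x : Fin (d + 1) → ℝ) (hx : Monotone x)
    (f : Fin (d + 1) → ℝ → ℝ) :
    Matrix.det (Matrix.of fun i j : Fin (d + 1) => f i (min (x i) (x j))) =
      f 0 (x 0) * ∏ i : Fin d, (f i.succ (x i.succ) - f i.succ (x i.castSucc)) := by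
  rw [Matrix.det_eq_of_forall_col_eq_smul_add_pred
    (B := Matrix.of fun i j : Fin (d + 1) => Fin.cases (f i (x 0))
      (fun k : Fin d => f i (min (x i) (x k.succ)) - f i (min (x i) (x k.castSucc))) j)
    (fun _ => 1)]
  · rw [Matrix.det_of_isLowerTriangular, Fin.prod_univ_succ]
    · congr 1
      refine Finset.prod_congr rfl fun i _ => ?_
      simp [min_eq_right (hx (Fin.castSucc_lt_succ (i := i)).le)]
    · intro i j hij
      have hlt : i < j := hij
      induction j using Fin.cases with
      | zero => exact absurd hlt (Fin.not_lt_zero i)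
      | succ k =>
        have hle : i ≤ k.castSucc := Fin.le_castSucc_iff.2 hlt
        simp [min_eq_left (hx hlt.le), min_eq_left (hx hle)]
  · intro i
    simp [min_eq_right (hx (Fin.zero_le i))]
  · intro i j
    simp
end

section
/- Let α, β ∈ ℝ, d ≥ 1, and 0 < t₁ ≤ t₂ ≤ … ≤ t_d. Then the d×d determinant det( (max(t_i,t_j))^α · (min(t_i,t_j))^{−β} )_{i,j=1,…,d} equals t_d^{α−β} · ∏_{i=1}^{d−1} ( t_i^{α+β} − t_{i+1}^{α+β} ) / t_i^{2β}. -/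
/-- The determinant of the single-pair matrix `(a (i ∨ j) * b (i ∧ j))`. -/
theorem Matrix.det_mul_max_min {K : Type*} [Field K] (d : ℕ) (a b : Fin (d + 1) → K)
    (hb : ∀ i, b i ≠ 0) :
    (Matrix.of fun i j => a (max i j) * b (min i j)).det =
      a (Fin.last d) * b (Fin.last d) *
        ∏ i : Fin d, (a i.castSucc / b i.castSucc - a i.succ / b i.succ) * b i.castSucc ^ 2 := by
  induction d with
  | zero => simp
  | succ d ih =>
    set M : Matrix (Fin (d + 2)) (Fin (d + 2)) K := Matrix.of fun i j => a (max i j) * b (min i j)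
      with hM
    have hrow : ∀ j : Fin (d + 1),
        (M.updateRow 0 (M 0 + (-(b 0 / b 1)) • M 1)) 0 j.succ = 0 := by
      intro j
      have hj : (1 : Fin (d + 2)) ≤ j.succ := by
        rw [← Fin.succ_zero_eq_one, Fin.succ_le_succ_iff]
        exact Fin.zero_le j
      have hb1 := hb 1
      simp only [Matrix.updateRow_self, Pi.add_apply, Pi.smul_apply, smul_eq_mul, hM,
        Matrix.of_apply, max_eq_right hj, min_eq_left hj, max_eq_right (Fin.zero_le j.succ),
        min_eq_left (Fin.zero_le j.succ)]
      field_simp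
      ring
    have hcorner : (M.updateRow 0 (M 0 + (-(b 0 / b 1)) • M 1)) 0 0 =
        (a 0 / b 0 - a 1 / b 1) * b 0 ^ 2 := by
      have hb0 := hb 0
      have hb1 := hb 1
      simp only [Matrix.updateRow_self, Pi.add_apply, Pi.smul_apply, smul_eq_mul, hM,
        Matrix.of_apply, max_self, min_self, max_eq_left (Fin.zero_le (1 : Fin (d + 2))),
        min_eq_right (Fin.zero_le (1 : Fin (d + 2)))]
      field_simp
      ring
    have hminor : (M.updateRow 0 (M 0 + (-(b 0 / b 1)) • M 1)).submatrix Fin.succ Fin.succ =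
        Matrix.of fun i j => a (max i j).succ * b (min i j).succ := by
      ext i j
      simp [hM, (Fin.strictMono_succ (n := d + 1)).monotone.map_max,
        (Fin.strictMono_succ (n := d + 1)).monotone.map_min]
    rw [← Matrix.det_updateRow_add_smul_self M (Fin.zero_ne_one (n := d)) (-(b 0 / b 1)),
      Matrix.det_succ_row_zero, Fin.sum_univ_succ]
    simp only [hrow, hcorner, Fin.succAbove_zero, hminor]
    rw [ih (fun i => a i.succ) (fun i => b i.succ) fun i => hb i.succ, Fin.prod_univ_succ]
    simp only [Fin.succ_last, Fin.succ_castSucc, Fin.castSucc_zero, Fin.succ_zero_eq_one,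
      Fin.val_zero, pow_zero, mul_zero, zero_mul, Finset.sum_const_zero, Nat.succ_eq_add_one]
    ring

/-- The determinant of the matrix `((t_i ∨ t_j)^α / (t_i ∧ t_j)^β)` for
`0 < t₀ ≤ t₁ ≤ … ≤ t_d`. -/
theorem det_max_min_rpow (α β : ℝ) (d : ℕ) (t : Fin (d + 1) → ℝ)
    (ht0 : 0 < t 0) (hmono : Monotone t) :
    Matrix.det (Matrix.of fun i j : Fin (d + 1) =>
        (max (t i) (t j)) ^ α * (min (t i) (t j)) ^ (-β)) =
      (t (Fin.last d)) ^ (α - β) *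
        ∏ i : Fin d,
          ((t i.castSucc) ^ (α + β) - (t i.succ) ^ (α + β)) / (t i.castSucc) ^ (2 * β) := by
  have ht : ∀ i, 0 < t i := fun i => ht0.trans_le (hmono (Fin.zero_le i))
  have hdiv : ∀ i, t i ^ α / t i ^ (-β) = t i ^ (α + β) := fun i => by
    rw [← Real.rpow_sub (ht i), sub_neg_eq_add]
  have hsq : ∀ i, (t i ^ (-β)) ^ 2 = (t i ^ (2 * β))⁻¹ := fun i => by
    rw [← Real.rpow_natCast, ← Real.rpow_mul (ht i).le, ← Real.rpow_neg (ht i).le]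
    congr 1
    push_cast
    ring
  simp only [← hmono.map_max, ← hmono.map_min]
  rw [Matrix.det_mul_max_min d (fun i => t i ^ α) (fun i => t i ^ (-β))
    fun i => (Real.rpow_pos_of_pos (ht i) _).ne']
  simp only [hdiv, hsq, ← Real.rpow_add (ht _), ← sub_eq_add_neg, ← div_eq_mul_inv]
end

section
/- Let α, β ∈ ℝ and define K : [0,∞)² → ℝ by K(s,t) = (max(s,t))^α · (min(s,t))^{−β} if min(s,t) > 0, and K(s,t) = 0 if min(s,t) = 0. Then K is positive definite (i.e., for every d ≥ 1, all t₁,…,t_d ≥ 0 and all reals a₁,…,a_d, Σ_{k,l=1}^d a_k·a_l·K(t_k,t_l) ≥ 0) if and only if α + β ≤ 0. -/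
open Real

/-- A lower bound for the quadratic form of the kernel `min`, which implies that this kernel is
positive definite on `[0,∞)`. -/
theorem mul_sum_sq_le_sum_sum_min {ι : Type*} (s : Finset ι) (u b : ι → ℝ) :
    ∀ c : ℝ, (∀ i ∈ s, c ≤ u i) →
      c * (∑ i ∈ s, b i) ^ 2 ≤ ∑ i ∈ s, ∑ j ∈ s, b i * b j * min (u i) (u j) := by
  classical
  induction s using Finset.induction_on_min_value u with
  | empty => simp
  | insert a s ha hmin ih =>
    intro c hc
    have hrow : ∑ j ∈ s, b a * b j * min (u a) (u j) = u a * b a * ∑ j ∈ s, b j := by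
      rw [Finset.mul_sum]
      refine Finset.sum_congr rfl fun j hj => ?_
      rw [min_eq_left (hmin j hj)]
      ring
    have hcol : ∑ i ∈ s, b i * b a * min (u i) (u a) = u a * b a * ∑ i ∈ s, b i := by
      rw [← hrow]
      refine Finset.sum_congr rfl fun i _ => ?_
      rw [min_comm, mul_comm (b i)]
    have hc' : c ≤ u a := hc a (Finset.mem_insert_self a s)
    have hsq := mul_le_mul_of_nonneg_right hc' (sq_nonneg (b a + ∑ i ∈ s, b i))
    simp only [Finset.sum_insert ha, Finset.sum_add_distrib, hrow, hcol, min_self]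
    nlinarith [ih (u a) hmin]

/-- The factorization `(s ∨ t)^α (s ∧ t)^{-β} = s^α t^α (s^γ ∧ t^γ)` with `γ = -(α + β) ≥ 0`. -/
theorem max_rpow_mul_min_rpow {α β s t : ℝ} (h : α + β ≤ 0) (hs : 0 < s) (ht : 0 < t) :
    (max s t) ^ α * (min s t) ^ (-β) =
      s ^ α * t ^ α * min (s ^ (-(α + β))) (t ^ (-(α + β))) := by
  wlog hst : s ≤ t generalizing s t
  · rw [max_comm, min_comm, this ht hs (le_of_not_ge hst), min_comm, mul_comm (t ^ α)]
  have hγ : 0 ≤ -(α + β) := by linarith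
  rw [max_eq_right hst, min_eq_left hst, min_eq_left (rpow_le_rpow hs.le hst hγ),
    show -β = α + -(α + β) by ring, rpow_add hs]
  ring_nf

/-- The kernel `K(s,t) = (s ∨ t)^α (s ∧ t)^{-β}` (set to `0` when `s ∧ t = 0`) is positive
definite on `[0,∞)` if and only if `α + β ≤ 0`. -/
theorem max_min_kernel_posDef_iff (α β : ℝ) :
    (∀ (d : ℕ), 1 ≤ d → ∀ (t : Fin d → ℝ) (a : Fin d → ℝ), (∀ i, 0 ≤ t i) →
      0 ≤ ∑ k : Fin d, ∑ l : Fin d, a k * a l *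
        (if 0 < min (t k) (t l) then
            (max (t k) (t l)) ^ α * (min (t k) (t l)) ^ (-β)
          else 0)) ↔ α + β ≤ 0 := by
  constructor
  · intro h
    have key := h 2 one_le_two ![1, 2] ![-(2 : ℝ) ^ α, 1] (by simp [Fin.forall_fin_two])
    simp [Fin.sum_univ_two] at key
    have hle : (2 : ℝ) ^ α * 2 ^ α ≤ 2 ^ α * 2 ^ (-β) := by linarith
    have hle' := le_of_mul_le_mul_left hle (rpow_pos_of_pos two_pos α)
    have := (rpow_le_rpow_left_iff (one_lt_two (α := ℝ))).1 hle'
    linarith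
  · intro h d _ t a ht
    have key := mul_sum_sq_le_sum_sum_min Finset.univ (fun k => t k ^ (-(α + β)))
      (fun k => a k * if 0 < t k then t k ^ α else 0) 0 fun k _ => rpow_nonneg (ht k) _
    rw [zero_mul] at key
    refine key.trans_eq (Finset.sum_congr rfl fun k _ => Finset.sum_congr rfl fun l _ => ?_)
    by_cases hk : 0 < t k
    · by_cases hl : 0 < t l
      · rw [if_pos hk, if_pos hl, if_pos (lt_min hk hl), max_rpow_mul_min_rpow h hk hl]
        ring
      · simp [hl]
    · simp [hk]
end

section
/- Let H > 0 and c < −H. Define the Volterra kernel K(u,t) = √(−2(c+H)) · t^{H−1/2} · (u/t)^{−c−H−1/2} for 0 < u ≤ t. Then for all s, t > 0, ∫₀^{min(s,t)} K(u,s)·K(u,t) du = (max(s,t))^{2H+c} · (min(s,t))^{−c}. -/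
open Real MeasureTheory intervalIntegral

/-- The Volterra kernel `K(u,t) = √(−2(c+H)) t^{H−1/2} (u/t)^{−c−H−1/2}` reproduces the
covariance `R_{H,c}(s,t) = (s ∨ t)^{2H+c} (s ∧ t)^{−c}`. -/
theorem volterra_kernel_reproduces_R (H c : ℝ) (hH : 0 < H) (hc : c < -H)
    (K : ℝ → ℝ → ℝ)
    (hK : ∀ u t : ℝ, K u t =
      Real.sqrt (-2 * (c + H)) * t ^ (H - 1/2) * (u / t) ^ (-c - H - 1/2)) :
    ∀ s t : ℝ, 0 < s → 0 < t →
      ∫ u in (0 : ℝ)..(min s t), K u s * K u t =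
        (max s t) ^ (2 * H + c) * (min s t) ^ (-c) := by
  have hK_pos : ∀ u t : ℝ, 0 < u → 0 < t →
      K u t = √(-2 * (c + H)) * t ^ (2 * H + c) * u ^ (-c - H - 1/2) := by
    intro u t hu ht
    have hpow : t ^ (H - 1/2) = t ^ (2 * H + c) * t ^ (-c - H - 1/2) := by
      rw [← rpow_add ht]
      ring_nf
    have := (rpow_pos_of_pos ht (-c - H - 1/2)).ne'
    rw [hK, div_rpow hu.le ht.le, hpow]
    field_simp
  intro s t hs ht
  wlog hst : s ≤ t generalizing s t
  · simpa only [min_comm, max_comm, mul_comm (K _ s)] using this t s ht hs (not_le.mp hst).le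
  rw [min_eq_left hst, max_eq_right hst]
  have hcH : 0 < -2 * (c + H) := by linarith
  have hprod : ∀ u ∈ Set.uIoc 0 s, K u s * K u t =
      (-2 * (c + H) * s ^ (2 * H + c) * t ^ (2 * H + c)) * u ^ (-2 * (c + H) - 1) := by
    intro u hu
    rw [Set.uIoc_of_le hs.le] at hu
    have hpow : u ^ (-2 * (c + H) - 1) = u ^ (-c - H - 1/2) * u ^ (-c - H - 1/2) := by
      rw [← rpow_add hu.1]
      ring_nf
    rw [hK_pos u s hu.1 hs, hK_pos u t hu.1 ht, hpow]
    linear_combination (s ^ (2 * H + c) * t ^ (2 * H + c) * u ^ (-c - H - 1/2) *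
      u ^ (-c - H - 1/2)) * mul_self_sqrt hcH.le
  have hpow : s ^ (-c) = s ^ (2 * H + c) * s ^ (-2 * (c + H)) := by
    rw [← rpow_add hs]
    ring_nf
  rw [integral_congr_ae (Filter.Eventually.of_forall hprod), intervalIntegral.integral_const_mul,
    integral_rpow (Or.inl (by linarith)), sub_add_cancel, zero_rpow hcH.ne', hpow, sub_zero,
    mul_div_assoc', div_eq_iff hcH.ne']
  ring
end

section
/- Let H > 0, R₁ > 0, and l : [0,∞) → ℝ with l(0) = 1 and l not identically zero on (0,∞). Define R : [0,∞)² → ℝ by R(s,t) = R₁ · (min(s,t))^{2H} · l( |s−t| / min(s,t) ) for min(s,t) > 0, and R(s,t) = 0 if min(s,t) = 0. Suppose R is positive definite and satisfies Doob's Markov criterion R(s,u)·R(t,t) = R(s,t)·R(t,u) for all 0 ≤ s ≤ t ≤ u. Then there exists a real number c ≤ −H such that for every α ∈ (0,1) and every t ≥ 1, l( t^{1−α} − 1 ) = t^{(2H+c) − α·(2H+c)}. -/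
open Real

/-- A nonnegative additive function on `[0, ∞)` is linear. -/
theorem eq_mul_of_additive_nonneg {h : ℝ → ℝ} (hn : ∀ v, 0 ≤ v → 0 ≤ h v)
    (ha : ∀ v w, 0 ≤ v → 0 ≤ w → h (v + w) = h v + h w) {v : ℝ} (hv : 0 ≤ v) :
    h v = v * h 1 := by
  have h0 : h 0 = 0 := by
    have := ha 0 0 le_rfl le_rfl
    rw [add_zero] at this
    linarith
  have hmul : ∀ (n : ℕ) (w : ℝ), 0 ≤ w → h (n * w) = n * h w := by
    intro n w hw
    induction n with
    | zero => simp [h0]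
    | succ k ih =>
      push_cast
      rw [add_mul, one_mul, ha _ _ (by positivity) hw, ih]
      ring
  have hmono : ∀ a b, 0 ≤ a → a ≤ b → h a ≤ h b := by
    intro a b h_a hab
    have h1 := ha a (b - a) h_a (by linarith)
    have h2 := hn (b - a) (by linarith)
    rw [add_sub_cancel] at h1
    linarith
  have key : ∀ n : ℕ, n * |h v - v * h 1| ≤ h 1 := by
    intro n
    have hnv : 0 ≤ n * v := by positivity
    have hm1 := Nat.floor_le hnv
    have hm2 := (Nat.lt_floor_add_one (n * v)).le
    have h1pos := hn 1 zero_le_one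
    have e1 := hmul ⌊n * v⌋₊ 1 zero_le_one
    have e2 := hmul (⌊n * v⌋₊ + 1) 1 zero_le_one
    have e3 := hmul n v hv
    push_cast at e2
    rw [mul_one] at e1 e2
    have i1 := hmono _ _ (by positivity) hm1
    have i2 := hmono _ _ hnv hm2
    rw [e1, e3] at i1
    rw [e2, e3] at i2
    have j1 := mul_le_mul_of_nonneg_right hm1 h1pos
    have j2 := mul_le_mul_of_nonneg_right hm2 h1pos
    rw [← abs_of_nonneg (Nat.cast_nonneg (α := ℝ) n), ← abs_mul, abs_le]
    constructor <;> linarith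
  by_contra hne
  have hpos : 0 < |h v - v * h 1| := abs_pos.mpr (sub_ne_zero.mpr hne)
  obtain ⟨n, hn'⟩ := exists_nat_gt (h 1 / |h v - v * h 1|)
  rw [div_lt_iff₀ hpos] at hn'
  linarith [key n]

/-- A multiplicative function on `[1, ∞)` that does not vanish identically on `(1, ∞)` is
positive. -/
theorem pos_of_multiplicative {f : ℝ → ℝ} (hm : ∀ a b, 1 ≤ a → 1 ≤ b → f (a * b) = f a * f b)
    (h1 : f 1 = 1) {x : ℝ} (hx : 1 < x) (hfx : f x ≠ 0) {y : ℝ} (hy : 1 ≤ y) : 0 < f y := by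
  have hpow : ∀ n : ℕ, f (x ^ n) = f x ^ n := by
    intro n
    induction n with
    | zero => simp [h1]
    | succ k ih => rw [pow_succ, hm _ _ (one_le_pow₀ hx.le) hx.le, ih, pow_succ]
  have hne : ∀ z, 1 ≤ z → f z ≠ 0 := by
    intro z hz h_z
    obtain ⟨n, hn⟩ := pow_unbounded_of_one_lt z hx
    have hz0 : 0 < z := by linarith
    have h2 := hm z (x ^ n / z) hz ((one_le_div hz0).mpr hn.le)
    rw [mul_div_cancel₀ _ hz0.ne', hpow, h_z, zero_mul] at h2
    exact pow_ne_zero n hfx h2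
  have hs : 1 ≤ √y := Real.one_le_sqrt.mpr hy
  have h3 := hm _ _ hs hs
  rw [Real.mul_self_sqrt (by linarith)] at h3
  rw [h3]
  exact mul_self_pos.mpr (hne _ hs)

/-- If a covariance of the form `R(s,t) = R₁ (s∧t)^{2H} l(|s−t|/(s∧t))` is positive definite
and satisfies Doob's Markov criterion, then `l(t^{1−α} − 1) = t^{(2H+c)−α(2H+c)}` for some
`c ≤ −H`, all `α ∈ (0,1)` and all `t ≥ 1`. -/
theorem markov_covariance_l_form
    (H R₁ : ℝ) (hH : 0 < H) (hR₁ : 0 < R₁)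
    (l : ℝ → ℝ) (hl0 : l 0 = 1) (hlne : ∃ x : ℝ, 0 < x ∧ l x ≠ 0)
    (R : ℝ → ℝ → ℝ)
    (hR : ∀ s t : ℝ, 0 ≤ s → 0 ≤ t → R s t =
      if 0 < min s t then R₁ * (min s t) ^ (2 * H) * l (|s - t| / min s t) else 0)
    (hposdef : ∀ (d : ℕ), 1 ≤ d → ∀ (t : Fin d → ℝ) (a : Fin d → ℝ),
      (∀ i, 0 ≤ t i) → 0 ≤ ∑ k : Fin d, ∑ l' : Fin d, a k * a l' * R (t k) (t l'))
    (hmarkov : ∀ s t u : ℝ, 0 ≤ s → s ≤ t → t ≤ u →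
      R s u * R t t = R s t * R t u) :
    ∃ c : ℝ, c ≤ -H ∧ ∀ α : ℝ, 0 < α → α < 1 → ∀ t : ℝ, 1 ≤ t →
      l (t ^ (1 - α) - 1) = t ^ ((2 * H + c) - α * (2 * H + c)) := by
  have hRv : ∀ s t : ℝ, 0 < s → s ≤ t → R s t = R₁ * s ^ (2 * H) * l (t / s - 1) := by
    intro s t hs hst
    rw [hR s t hs.le (hs.le.trans hst), min_eq_left hst, if_pos hs, abs_sub_comm,
      abs_of_nonneg (sub_nonneg.mpr hst), sub_div, div_self hs.ne']
  have hdiag : ∀ s : ℝ, 0 < s → R s s = R₁ * s ^ (2 * H) := by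
    intro s hs
    rw [hRv s s hs le_rfl, div_self hs.ne', sub_self, hl0, mul_one]
  have hmult : ∀ a b : ℝ, 1 ≤ a → 1 ≤ b → l (a * b - 1) = l (a - 1) * l (b - 1) := by
    intro a b h_a h_b
    have ha0 : 0 < a := by linarith
    have hab : a ≤ a * b := le_mul_of_one_le_right ha0.le h_b
    have h1 := hmarkov 1 a (a * b) zero_le_one h_a hab
    rw [hRv 1 (a * b) one_pos (h_a.trans hab), hdiag a ha0, hRv 1 a one_pos h_a,
      hRv a (a * b) ha0 hab, mul_div_cancel_left₀ _ ha0.ne', one_rpow, div_one, div_one] at h1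
    have hp : 0 < R₁ * (R₁ * a ^ (2 * H)) := by positivity
    apply mul_left_cancel₀ hp.ne'
    linarith
  obtain ⟨x, hx, hlx⟩ := hlne
  have hpos : ∀ y : ℝ, 1 ≤ y → 0 < l (y - 1) := fun y hy =>
    pos_of_multiplicative (f := fun z => l (z - 1)) hmult (by simpa using hl0)
      (x := x + 1) (by linarith) (by simpa using hlx) hy
  have hbound : ∀ y : ℝ, 1 ≤ y → l (y - 1) ≤ y ^ H := by
    intro y hy
    have hy0 : 0 < y := by linarith
    have h1 := hposdef 2 one_le_two ![1, y] ![l (y - 1), -1] (by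
      intro i
      fin_cases i
      · exact zero_le_one
      · exact hy0.le)
    have hsymm : R y 1 = R 1 y := by
      rw [hR y 1 hy0.le zero_le_one, hR 1 y zero_le_one hy0.le, min_comm, abs_sub_comm]
    simp only [Fin.sum_univ_two, Matrix.cons_val_zero, Matrix.cons_val_one] at h1
    rw [hsymm, hdiag 1 one_pos, hdiag y hy0, hRv 1 y one_pos hy, one_rpow, div_one] at h1
    have h2 : 0 ≤ R₁ * (y ^ (2 * H) - l (y - 1) ^ 2) := by linarith
    have h3 := nonneg_of_mul_nonneg_right h2 hR₁
    have h4 : y ^ (2 * H) = (y ^ H) ^ 2 := by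
      rw [mul_comm, rpow_mul hy0.le, rpow_two]
    rw [h4] at h3
    exact le_of_sq_le_sq (by linarith) (by positivity)
  have hexp : ∀ v : ℝ, 0 ≤ v → 1 ≤ exp v := fun v hv => one_le_exp hv
  set h : ℝ → ℝ := fun v => H * v - log (l (exp v - 1)) with hdef
  have hnonneg : ∀ v, 0 ≤ v → 0 ≤ h v := by
    intro v hv
    have h1 := log_le_log (hpos _ (hexp v hv)) (hbound _ (hexp v hv))
    rw [log_rpow (exp_pos v), log_exp] at h1
    exact sub_nonneg.mpr h1
  have hadd : ∀ v w, 0 ≤ v → 0 ≤ w → h (v + w) = h v + h w := by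
    intro v w hv hw
    simp only [hdef]
    rw [exp_add, hmult _ _ (hexp v hv) (hexp w hw),
      log_mul (hpos _ (hexp v hv)).ne' (hpos _ (hexp w hw)).ne']
    ring
  refine ⟨-H - h 1, by linarith [hnonneg 1 zero_le_one], ?_⟩
  intro α _ hα t ht
  have ht0 : 0 < t := by linarith
  have hv : 0 ≤ log t * (1 - α) := mul_nonneg (log_nonneg ht) (by linarith)
  have hlin := eq_mul_of_additive_nonneg hnonneg hadd hv
  have hlog : log (l (exp (log t * (1 - α)) - 1)) = log t * (1 - α) * (H - h 1) := by
    have : h (log t * (1 - α)) =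
      H * (log t * (1 - α)) - log (l (exp (log t * (1 - α)) - 1)) := rfl
    linarith
  rw [rpow_def_of_pos ht0, rpow_def_of_pos ht0, ← exp_log (hpos _ (hexp _ hv)), hlog]
  congr 1
  ring
end

section
/- Let H > 0 and let A, B : ℝ → ℝ be such that A − B is nondecreasing and A(y+u) + B(y+v) = 2H·y + A(u) + B(v) for all real y and all u ≤ v. Then there exist real numbers a and b with a + b = 2H such that A(x) = A(0) + a·x and B(x) = B(0) + b·x for all x ∈ ℝ. -/
/-- A monotone additive function on the reals is linear. -/
lemma eq_map_one_mul_of_monotone_of_additive {f : ℝ → ℝ} (hf : Monotone f)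
    (hadd : ∀ x y, f (x + y) = f x + f y) (x : ℝ) : f x = f 1 * x := by
  let g : ℝ →+ ℝ := AddMonoidHom.mk' f hadd
  have hg : Continuous g := MeasureTheory.Measure.AddMonoidHom.continuous_of_measurable g hf.measurable
  have h := map_real_smul g hg x 1
  simp only [smul_eq_mul, mul_one] at h
  exact h.trans (mul_comm _ _)

/-- If `A − B` is nondecreasing and `A(y+u) + B(y+v) = 2Hy + A(u) + B(v)` for all real `y`
and all `u ≤ v`, then `A` and `B` are affine with slopes summing to `2H`. -/
theorem affine_from_functional_equation (H : ℝ) (hH : 0 < H) (A B : ℝ → ℝ)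
    (hmono : Monotone fun x => A x - B x)
    (heq : ∀ y u v : ℝ, u ≤ v → A (y + u) + B (y + v) = 2 * H * y + A u + B v) :
    ∃ a b : ℝ, a + b = 2 * H ∧
      ∀ x : ℝ, A x = A 0 + a * x ∧ B x = B 0 + b * x := by
  have hB (y v : ℝ) : B (y + v) - B v = B y - B 0 := by
    have h₁ := heq y (min v 0) v (min_le_left _ _)
    have h₂ := heq y (min v 0) 0 (min_le_right _ _)
    rw [add_zero] at h₂
    linarith
  have hA (y u : ℝ) : A (y + u) - A u = A y - A 0 := by
    have h₁ := heq y u (max u 0) (le_max_left _ _)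
    have h₂ := heq y 0 (max u 0) (le_max_right _ _)
    rw [add_zero] at h₂
    linarith
  have hsum (x : ℝ) : A x + B x = 2 * H * x + A 0 + B 0 := by
    simpa using heq x 0 0 le_rfl
  let D : ℝ → ℝ := fun x => A x - B x - (A 0 - B 0)
  have hD : Monotone D := fun x y hxy => sub_le_sub_right (hmono hxy) _
  have hlin := eq_map_one_mul_of_monotone_of_additive hD fun x y => by
    linarith [hA x y, hB x y]
  refine ⟨H + D 1 / 2, H - D 1 / 2, by ring, fun x => ?_⟩
  have hx : A x - B x - (A 0 - B 0) = D 1 * x := hlin x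
  constructor <;> linarith [hsum x]
end

section
/- Let R : [0,∞)² → ℝ be symmetric, positive definite, satisfy Doob's Markov criterion R(s,u)·R(t,t) = R(s,t)·R(t,u) for all 0 ≤ s ≤ t ≤ u, with R(s,t) > 0 whenever s,t > 0 and R(s,t) = 0 whenever min(s,t) = 0. Then there exist functions G, F : [0,∞) → ℝ with G(0) = F(0) = 0, G and F strictly positive on (0,∞), such that R(s,t) = G(min(s,t))·F(max(s,t)) for all s,t ≥ 0, and the ratio G/F is nondecreasing on (0,∞). -/
/-- The Cauchy–Schwarz inequality for a positive definite function on `[0,∞)²`. -/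
theorem sq_le_mul_of_posdef (R : ℝ → ℝ → ℝ)
    (hposdef : ∀ (d : ℕ), 1 ≤ d → ∀ (t : Fin d → ℝ) (a : Fin d → ℝ),
      (∀ i, 0 ≤ t i) → 0 ≤ ∑ k : Fin d, ∑ l : Fin d, a k * a l * R (t k) (t l))
    {x y : ℝ} (hx : 0 ≤ x) (hy : 0 ≤ y) (hxy : R x y = R y x) (hxx : 0 < R x x) :
    R x y ^ 2 ≤ R x x * R y y := by
  have h := hposdef 2 (by norm_num) ![x, y] ![R x y, -R x x]
    (by intro i; fin_cases i <;> simpa)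
  simp only [Fin.sum_univ_two, Matrix.cons_val_zero, Matrix.cons_val_one] at h
  rw [← hxy] at h
  have h' : 0 ≤ R x x * (R x x * R y y - R x y ^ 2) := by linarith
  linarith [nonneg_of_mul_nonneg_right h' hxx]

/-- Borisov-type factorization: a symmetric, positive definite covariance satisfying Doob's
Markov criterion, positive off the axes and vanishing on them, factors as
`R(s,t) = G(s∧t) F(s∨t)` with `G/F` nondecreasing on `(0,∞)`. -/
theorem borisov_factorization (R : ℝ → ℝ → ℝ)
    (hsymm : ∀ s t : ℝ, 0 ≤ s → 0 ≤ t → R s t = R t s)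
    (hposdef : ∀ (d : ℕ), 1 ≤ d → ∀ (t : Fin d → ℝ) (a : Fin d → ℝ),
      (∀ i, 0 ≤ t i) → 0 ≤ ∑ k : Fin d, ∑ l : Fin d, a k * a l * R (t k) (t l))
    (hmarkov : ∀ s t u : ℝ, 0 ≤ s → s ≤ t → t ≤ u →
      R s u * R t t = R s t * R t u)
    (hpos : ∀ s t : ℝ, 0 < s → 0 < t → 0 < R s t)
    (hzero : ∀ s t : ℝ, 0 ≤ s → 0 ≤ t → min s t = 0 → R s t = 0) :
    ∃ G F : ℝ → ℝ, G 0 = 0 ∧ F 0 = 0 ∧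
      (∀ x : ℝ, 0 < x → 0 < G x ∧ 0 < F x) ∧
      (∀ s t : ℝ, 0 ≤ s → 0 ≤ t → R s t = G (min s t) * F (max s t)) ∧
      (∀ x y : ℝ, 0 < x → x ≤ y → G x / F x ≤ G y / F y) := by
  let G : ℝ → ℝ := fun t => if t ≤ 1 then R t 1 else R t t * R 1 1 / R 1 t
  let F : ℝ → ℝ := fun t => if t ≤ 1 then R t t / R t 1 else R 1 t / R 1 1
  have h11 := hpos 1 1 one_pos one_pos
  have hG0 : G 0 = 0 := by simp [G, hzero 0 1]
  have hF0 : F 0 = 0 := by simp [F, hzero 0 1]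
  have hGF : ∀ x, 0 < x → 0 < G x ∧ 0 < F x := by
    intro x hx
    have h1 := hpos x 1 hx one_pos
    have h2 := hpos 1 x one_pos hx
    have h3 := hpos x x hx hx
    dsimp only [G, F]
    split_ifs <;> constructor <;> positivity
  have hfac : ∀ s t, 0 ≤ s → s ≤ t → R s t = G s * F t := by
    intro s t hs hst
    rcases hs.eq_or_lt with rfl | hs'
    · rw [hG0, zero_mul, hzero 0 t le_rfl hst (min_eq_left hst)]
    have ht := hs'.trans_le hst
    have ht1 := hpos t 1 ht one_pos
    have h1s := hpos 1 s one_pos hs'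
    dsimp only [G, F]
    split_ifs with h1 h2 h2
    · field_simp
      linarith [hmarkov s t 1 hs hst h2]
    · field_simp
      linarith [hmarkov s 1 t hs h1 (not_le.mp h2).le]
    · exact absurd (hst.trans h2) h1
    · field_simp
      linarith [hmarkov 1 s t zero_le_one (not_le.mp h1).le hst]
  refine ⟨G, F, hG0, hF0, hGF, fun s t hs ht => ?_, fun x y hx hxy => ?_⟩
  · rcases le_total s t with h | h
    · rw [min_eq_left h, max_eq_right h, hfac s t hs h]
    · rw [min_eq_right h, max_eq_left h, hsymm s t hs ht, hfac t s ht h]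
  · have hy := hx.trans_le hxy
    obtain ⟨hGx, hFx⟩ := hGF x hx
    obtain ⟨hGy, hFy⟩ := hGF y hy
    have hcs := sq_le_mul_of_posdef R hposdef hx.le hy.le (hsymm x y hx.le hy.le) (hpos x x hx hx)
    rw [hfac x y hx.le hxy, hfac x x hx.le le_rfl, hfac y y hy.le le_rfl] at hcs
    rw [div_le_div_iff₀ hFx hFy]
    refine le_of_mul_le_mul_left ?_ (mul_pos hGx hFy)
    linarith
end

section
/- Let H ∈ (0,∞) with H ≠ 1/2, and define R(s,t) = Γ(H+1/2)^{−2} · ∫₀^{min(s,t)} ((s−u)·(t−u))^{H−1/2} du for s,t > 0. Then R does not satisfy Doob's Markov criterion: there exist 0 < s ≤ t ≤ u with R(s,u)·R(t,t) ≠ R(s,t)·R(t,u). -/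
open Real MeasureTheory intervalIntegral

open Filter Topology

lemma integral_sub_rpow (s : ℝ) {b : ℝ} (hb : -1 < b) :
    ∫ v in (0 : ℝ)..s, (s - v) ^ b = s ^ (b + 1) / (b + 1) := by
  rw [intervalIntegral.integral_comp_sub_left (fun x : ℝ => x ^ b) s, sub_self, sub_zero,
    integral_rpow (Or.inl hb), zero_rpow (by linarith), sub_zero]

lemma integral_mul_self_sub_rpow {t : ℝ} (ht : 0 < t) {a : ℝ} (ha : -1 / 2 < a) :
    ∫ v in (0 : ℝ)..t, ((t - v) * (t - v)) ^ a = t ^ (2 * a + 1) / (2 * a + 1) := by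
  rw [← integral_sub_rpow t (by linarith : -1 < 2 * a)]
  refine intervalIntegral.integral_congr fun v hv => ?_
  rw [Set.uIcc_of_le ht.le] at hv
  have hv' : 0 ≤ t - v := sub_nonneg.2 hv.2
  rw [← sq, ← rpow_natCast, ← rpow_mul hv', Nat.cast_ofNat]

/-- The Riemann–Liouville covariance kernel at `(s, u)`, normalized by `u ^ a`, converges as
`u → ∞`. -/
lemma tendsto_integral_mul_rpow_div_rpow {s : ℝ} (hs : 0 < s) {a : ℝ} (ha : -1 < a) :
    Tendsto (fun u : ℝ => (∫ v in (0 : ℝ)..s, ((s - v) * (u - v)) ^ a) / u ^ a) atTop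
      (𝓝 (s ^ (a + 1) / (a + 1))) := by
  have hint : IntervalIntegrable (fun v : ℝ => (s - v) ^ a) volume 0 s := by
    have h : IntervalIntegrable (fun x : ℝ => x ^ a) volume 0 s := intervalIntegrable_rpow' ha
    simpa using (h.comp_sub_left s).symm
  have hlim : Tendsto (fun u : ℝ => ∫ v in (0 : ℝ)..s, (s - v) ^ a * (1 - v / u) ^ a) atTop
      (𝓝 (∫ v in (0 : ℝ)..s, (s - v) ^ a)) := by
    refine intervalIntegral.tendsto_integral_filter_of_dominated_convergence
      (fun v => (s - v) ^ a * (1 + (1 / 2) ^ a)) ?_ ?_ (hint.mul_const _) ?_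
    · exact Eventually.of_forall fun u => Measurable.aestronglyMeasurable (by fun_prop)
    · filter_upwards [eventually_ge_atTop (2 * s)] with u hu
      refine Eventually.of_forall fun v hv => ?_
      rw [Set.uIoc_of_le hs.le] at hv
      have hu0 : 0 < u := by linarith
      have h1 : v / u ≤ 1 / 2 := by
        rw [div_le_iff₀ hu0]
        linarith [hv.2]
      have h0 : 0 ≤ v / u := div_nonneg hv.1.le hu0.le
      have hsv : 0 ≤ (s - v) ^ a := rpow_nonneg (sub_nonneg.2 hv.2) _
      have hbound : (1 - v / u) ^ a ≤ 1 + (1 / 2) ^ a := by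
        rcases le_total 0 a with h | h
        · linarith [rpow_le_one (by linarith : 0 ≤ 1 - v / u) (by linarith) h,
            rpow_nonneg (by norm_num : (0 : ℝ) ≤ 1 / 2) a]
        · linarith [rpow_le_rpow_of_nonpos (by norm_num : (0 : ℝ) < 1 / 2)
            (by linarith : 1 / 2 ≤ 1 - v / u) h]
      rw [norm_of_nonneg (mul_nonneg hsv (rpow_nonneg (by linarith) _))]
      exact mul_le_mul_of_nonneg_left hbound hsv
    · refine Eventually.of_forall fun v _ => ?_
      have hv : Tendsto (fun u : ℝ => 1 - v / u) atTop (𝓝 1) := by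
        simpa using (tendsto_const_nhds (x := (1 : ℝ))).sub (tendsto_id.const_div_atTop v)
      simpa using (hv.rpow_const (p := a) (Or.inl one_ne_zero)).const_mul ((s - v) ^ a)
  rw [integral_sub_rpow s ha] at hlim
  refine hlim.congr' ?_
  filter_upwards [eventually_ge_atTop s] with u hu
  have hu0 : 0 < u := hs.trans_le hu
  rw [← intervalIntegral.integral_div]
  refine intervalIntegral.integral_congr fun v hv => ?_
  rw [Set.uIcc_of_le hs.le] at hv
  have huv : 0 ≤ u - v := by linarith [hv.2]
  rw [mul_rpow (sub_nonneg.2 hv.2) huv, mul_div_assoc, ← div_rpow huv hu0.le, sub_div,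
    div_self hu0.ne']

/-- The Riemann–Liouville process with Hurst parameter `H ≠ 1/2` is not Markov: its
covariance fails Doob's criterion. -/
theorem riemann_liouville_not_markov (H : ℝ) (hH : 0 < H) (hH' : H ≠ 1/2)
    (R : ℝ → ℝ → ℝ)
    (hR : ∀ s t : ℝ, 0 < s → 0 < t → R s t =
      (Real.Gamma (H + 1/2))⁻¹ ^ 2 *
        ∫ u in (0 : ℝ)..(min s t), ((s - u) * (t - u)) ^ (H - 1/2)) :
    ∃ s t u : ℝ, 0 < s ∧ s ≤ t ∧ t ≤ u ∧ R s u * R t t ≠ R s t * R t u := by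
  by_contra! hdoob
  obtain ⟨a, rfl⟩ : ∃ a, H = a + 1 / 2 := ⟨H - 1 / 2, by ring⟩
  have ha : -1 / 2 < a := by linarith
  have ha0 : a ≠ 0 := fun h => hH' (by rw [h, zero_add])
  have ha1 : -1 < a := by linarith
  rw [add_sub_cancel_right] at hR
  set c := (Real.Gamma (a + 1 / 2 + 1 / 2))⁻¹ ^ 2
  have hc : c ≠ 0 := pow_ne_zero _ (inv_ne_zero (Gamma_pos_of_pos (by linarith)).ne')
  let J : ℝ → ℝ → ℝ := fun s u => ∫ v in (0 : ℝ)..s, ((s - v) * (u - v)) ^ a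
  have hRJ : ∀ s u, 0 < s → s ≤ u → R s u = c * J s u := fun s u hs hsu => by
    rw [hR s u hs (hs.trans_le hsu), min_eq_left hsu]
  have hlim : ∀ s, 0 < s → Tendsto (fun u => J s u / u ^ a) atTop (𝓝 (s ^ (a + 1) / (a + 1))) :=
    fun s hs => tendsto_integral_mul_rpow_div_rpow hs ha1
  have hconst : ∀ t, 1 ≤ t → J 1 t / t ^ a = 1 / (2 * a + 1) := fun t ht => by
    have ht0 : 0 < t := one_pos.trans_le ht
    have hEq : (fun u => J 1 u / u ^ a * J t t) =ᶠ[atTop] fun u => J 1 t * (J t u / u ^ a) := by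
      filter_upwards [eventually_ge_atTop t] with u hu
      have h := hdoob 1 t u one_pos ht hu
      rw [hRJ 1 u one_pos (ht.trans hu), hRJ t t ht0 le_rfl, hRJ 1 t one_pos ht,
        hRJ t u ht0 hu] at h
      have h' : J 1 u * J t t = J 1 t * J t u :=
        mul_left_cancel₀ (mul_ne_zero hc hc) (by linear_combination h)
      rw [div_mul_eq_mul_div, h', mul_div_assoc]
    have h := tendsto_nhds_unique_of_eventuallyEq ((hlim 1 one_pos).mul_const (J t t))
      ((hlim t ht0).const_mul (J 1 t)) hEq
    have hdiag : J t t = t ^ (2 * a + 1) / (2 * a + 1) := integral_mul_self_sub_rpow ht0 ha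
    rw [hdiag, one_rpow, show 2 * a + 1 = a + (a + 1) by ring, rpow_add ht0] at h
    have hp := (rpow_pos_of_pos ht0 a).ne'
    have hq := (rpow_pos_of_pos ht0 (a + 1)).ne'
    have h1 : a + 1 ≠ 0 := by linarith
    have h2 : a + (a + 1) ≠ 0 := by linarith
    rw [show 2 * a + 1 = a + (a + 1) by ring, div_eq_div_iff hp h2]
    field_simp at h
    linear_combination -h
  have h := tendsto_nhds_unique_of_eventuallyEq (hlim 1 one_pos)
    (tendsto_const_nhds (x := 1 / (2 * a + 1)))
    ((eventually_ge_atTop 1).mono hconst)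
  rw [one_rpow, div_eq_div_iff (by linarith) (by linarith)] at h
  exact ha0 (by linarith)
end

section
/- Let H ∈ (0,1) with H ≠ 1/2, and define R(s,t) = s^{2H} + t^{2H} − (1/2)·((s+t)^{2H} + |s−t|^{2H}) for s,t ≥ 0. Then R does not satisfy Doob's Markov criterion: there exist 0 < s ≤ t ≤ u with R(s,u)·R(t,t) ≠ R(s,t)·R(t,u). -/
open Real

/-- The symmetric second difference of `x ↦ x ^ (2 * H)` with unit step is `O(x ^ (2 * H - 2))`
for `H ∈ [0, 1]`. -/
lemma abs_secondDiff_rpow_le {H x : ℝ} (hH0 : 0 ≤ H) (hH1 : H ≤ 1) (hx : 1 ≤ x) :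
    |x ^ (2 * H) - (1/2) * ((1 + x) ^ (2 * H) + (x - 1) ^ (2 * H))| ≤ x ^ (-(2 - 2 * H)) := by
  have hx0 : 0 < x := by linarith
  have hsq : ∀ y : ℝ, 0 ≤ y → y ^ (2 * H) = (y ^ 2) ^ H := fun y hy => by
    rw [rpow_mul hy, rpow_two]
  have hinv : x ^ (-(2 - 2 * H)) = x ^ (2 * H) * (x ^ 2)⁻¹ := by
    rw [neg_sub, rpow_sub hx0, rpow_two, div_eq_mul_inv]
  have hinv1 : (x ^ 2)⁻¹ ≤ 1 := inv_le_one_of_one_le₀ (by nlinarith)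
  have hinv0 : 0 < (x ^ 2)⁻¹ := by positivity
  have hpos : 0 < x ^ (2 * H) := rpow_pos_of_pos hx0 _
  have upper : (1/2) * ((1 + x) ^ (2 * H) + (x - 1) ^ (2 * H)) ≤
      x ^ (2 * H) * (1 + (x ^ 2)⁻¹) := by
    have hconc := (concaveOn_rpow hH0 hH1).2 (Set.mem_Ici.2 (sq_nonneg (1 + x)))
      (Set.mem_Ici.2 (sq_nonneg (x - 1))) one_half_pos.le one_half_pos.le (add_halves 1)
    simp only [smul_eq_mul] at hconc
    rw [← hsq _ (by linarith), ← hsq _ (by linarith),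
      show 1/2 * (1 + x) ^ 2 + 1/2 * (x - 1) ^ 2 = x ^ 2 * (1 + (x ^ 2)⁻¹) by field_simp; ring,
      mul_rpow (by positivity) (by positivity), ← hsq x hx0.le] at hconc
    have hbern := rpow_one_add_le_one_add_mul_self (s := (x ^ 2)⁻¹) (by linarith) hH0 hH1
    have : (1 + (x ^ 2)⁻¹) ^ H ≤ 1 + (x ^ 2)⁻¹ := by nlinarith
    nlinarith [mul_le_mul_of_nonneg_left this hpos.le]
  have lower : x ^ (2 * H) * (1 - (x ^ 2)⁻¹) ≤
      (1/2) * ((1 + x) ^ (2 * H) + (x - 1) ^ (2 * H)) := by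
    have hprod : (1 + x) ^ H * (x - 1) ^ H = x ^ (2 * H) * (1 - (x ^ 2)⁻¹) ^ H := by
      rw [← mul_rpow (by linarith) (by linarith), hsq x hx0.le,
        ← mul_rpow (by positivity) (by linarith)]
      congr 1
      field_simp
      ring
    have hle : 1 - (x ^ 2)⁻¹ ≤ (1 - (x ^ 2)⁻¹) ^ H :=
      self_le_rpow_of_le_one (by linarith) (by linarith) hH1
    have hpow : ∀ y : ℝ, 0 ≤ y → y ^ (2 * H) = (y ^ H) ^ 2 := fun y hy => by
      rw [mul_comm, rpow_mul hy, rpow_two]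
    rw [hpow (1 + x) (by linarith), hpow (x - 1) (by linarith)]
    nlinarith [mul_le_mul_of_nonneg_left hle hpos.le, sq_nonneg ((1 + x) ^ H - (x - 1) ^ H)]
  rw [hinv, abs_le]
  constructor <;> linarith

lemma tendsto_secondDiff_rpow {H : ℝ} (hH0 : 0 ≤ H) (hH1 : H < 1) :
    Filter.Tendsto (fun x : ℝ => x ^ (2 * H) - (1/2) * ((1 + x) ^ (2 * H) + (x - 1) ^ (2 * H)))
      Filter.atTop (nhds 0) := by
  refine squeeze_zero_norm' ?_ (tendsto_rpow_neg_atTop (y := 2 - 2 * H) (by linarith))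
  filter_upwards [Filter.eventually_ge_atTop 1] with x hx
  exact abs_secondDiff_rpow_le hH0 hH1.le hx

/-- Sub-fractional Brownian motion with `H ∈ (0,1) \ {1/2}` is not Markov: its covariance
fails Doob's criterion. -/
theorem subfractional_not_markov (H : ℝ) (hH0 : 0 < H) (hH1 : H < 1) (hH' : H ≠ 1/2)
    (R : ℝ → ℝ → ℝ)
    (hR : ∀ s t : ℝ, 0 ≤ s → 0 ≤ t → R s t =
      s ^ (2 * H) + t ^ (2 * H) - (1/2) * ((s + t) ^ (2 * H) + |s - t| ^ (2 * H))) :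
    ∃ s t u : ℝ, 0 < s ∧ s ≤ t ∧ t ≤ u ∧ R s u * R t t ≠ R s t * R t u := by
  by_contra! hmarkov
  have hscale : ∀ x s t : ℝ, 0 ≤ x → 0 ≤ s → 0 ≤ t →
      R (x * s) (x * t) = x ^ (2 * H) * R s t := fun x s t hx hs ht => by
    rw [hR _ _ (by positivity) (by positivity), hR _ _ hs ht, ← mul_add, ← mul_sub, abs_mul,
      abs_of_nonneg hx, mul_rpow hx hs, mul_rpow hx ht, mul_rpow hx (by positivity),
      mul_rpow hx (abs_nonneg _)]
    ring
  have hmul : ∀ x : ℝ, 1 ≤ x → R 1 (x * x) * R 1 1 = R 1 x * R 1 x := fun x hx => by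
    have hx0 : 0 < x := by linarith
    have h := hmarkov 1 x (x * x) one_pos hx (by nlinarith)
    have h1 := hscale x 1 1 hx0.le zero_le_one zero_le_one
    have h2 := hscale x 1 x hx0.le zero_le_one hx0.le
    rw [mul_one] at h1 h2
    rw [h1, h2] at h
    exact mul_left_cancel₀ (rpow_pos_of_pos hx0 (2 * H)).ne' (by linarith)
  have hlim : Filter.Tendsto (R 1) Filter.atTop (nhds 1) := by
    have h := (tendsto_secondDiff_rpow hH0.le hH1).const_add 1
    rw [add_zero] at h
    refine h.congr' ?_
    filter_upwards [Filter.eventually_ge_atTop 1] with x hx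
    rw [hR 1 x zero_le_one (by linarith), abs_sub_comm, abs_of_nonneg (sub_nonneg.2 hx), one_rpow]
    ring
  have hone : R 1 1 = 1 := by
    have hleft := (hlim.comp (Filter.tendsto_id.atTop_mul_atTop₀ Filter.tendsto_id)).mul_const
      (R 1 1)
    have hright := hlim.mul hlim
    rw [one_mul] at hleft hright
    refine tendsto_nhds_unique (hleft.congr' ?_) hright
    filter_upwards [Filter.eventually_ge_atTop 1] with x hx
    exact hmul x hx
  rw [hR 1 1 zero_le_one zero_le_one, sub_self, abs_zero, one_rpow,
    zero_rpow (by linarith), one_add_one_eq_two] at hone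
  have htwo : (2 : ℝ) ^ (2 * H) = 2 ^ (1 : ℝ) := by
    rw [rpow_one]
    linarith
  have hexp := (strictMono_rpow_of_base_gt_one one_lt_two).injective htwo
  exact hH' (by linarith)
end

section
/- Let H̃ ∈ (0,1) and K̃ ∈ (0,1] with (H̃, K̃) ≠ (1/2, 1), and define R(s,t) = 2^{−K̃} · ( (s^{2H̃} + t^{2H̃})^{K̃} − |s−t|^{2H̃K̃} ) for s,t ≥ 0. Then R does not satisfy Doob's Markov criterion: there exist 0 < s ≤ t ≤ u with R(s,u)·R(t,t) ≠ R(s,t)·R(t,u). -/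
open Real

/-- The profile `t ↦ 2 ^ K * R t 1` of the covariance of bi-fractional Brownian motion, with
`a = 2 * H` and `p = 2 * H * K`. -/
noncomputable def bifractionalProfile (a K p t : ℝ) : ℝ := (1 + t ^ a) ^ K - (1 - t) ^ p

lemma bifractionalProfile_one {a K p : ℝ} (hp : 0 < p) :
    bifractionalProfile a K p 1 = 2 ^ K := by
  simp [bifractionalProfile, Real.zero_rpow hp.ne', one_add_one_eq_two]

lemma hasDerivAt_one_add_rpow_rpow {a K t : ℝ} (ht : 0 ≤ t) (h : t ≠ 0 ∨ 1 ≤ a) :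
    HasDerivAt (fun x : ℝ => (1 + x ^ a) ^ K)
      (a * t ^ (a - 1) * K * (1 + t ^ a) ^ (K - 1)) t := by
  have h1 : (1 + t ^ a : ℝ) ≠ 0 := by positivity
  exact ((Real.hasDerivAt_rpow_const h).const_add 1).rpow_const (Or.inl h1)

lemma hasDerivAt_one_sub_rpow {p t : ℝ} (h : 1 - t ≠ 0 ∨ 1 ≤ p) :
    HasDerivAt (fun x : ℝ => (1 - x) ^ p) (-1 * p * (1 - t) ^ (p - 1)) t :=
  ((hasDerivAt_id t).const_sub 1).rpow_const h

lemma hasDerivAt_bifractionalProfile {a K p t : ℝ} (ht : 0 ≤ t) (ha : t ≠ 0 ∨ 1 ≤ a)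
    (hp : 1 - t ≠ 0 ∨ 1 ≤ p) :
    HasDerivAt (bifractionalProfile a K p)
      (a * t ^ (a - 1) * K * (1 + t ^ a) ^ (K - 1) - -1 * p * (1 - t) ^ (p - 1)) t :=
  (hasDerivAt_one_add_rpow_rpow ht ha).sub (hasDerivAt_one_sub_rpow hp)

/-- For `0 < p < 1`, the function `(1 - x) ^ p` has no left derivative at `1`. -/
lemma not_hasDerivWithinAt_one_sub_rpow {p L : ℝ} (hp0 : 0 < p) (hp1 : p < 1) :
    ¬ HasDerivWithinAt (fun x : ℝ => (1 - x) ^ p) L (Set.Iic 1) 1 := by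
  intro h
  have hinv : 1 < p⁻¹ := (one_lt_inv₀ hp0).2 hp1
  have h1 := h.rpow_const (p := p⁻¹) (Or.inr hinv.le)
  have h2 : HasDerivWithinAt (fun x : ℝ => 1 - x) (-1) (Set.Iic 1) 1 :=
    ((hasDerivAt_id (1 : ℝ)).const_sub 1).hasDerivWithinAt
  have h3 := h2.congr_of_mem (f₁ := fun x : ℝ => ((1 - x) ^ p) ^ p⁻¹)
    (fun x hx => Real.rpow_rpow_inv (sub_nonneg.2 hx) hp0.ne') Set.self_mem_Iic
  have h4 := (uniqueDiffOn_Iic (1 : ℝ) 1 Set.self_mem_Iic).eq_deriv _ h1 h3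
  simp [Real.zero_rpow hp0.ne', Real.zero_rpow (sub_pos.2 hinv).ne'] at h4

/-- For `p < 1` the profile is not multiplicative up to the normalization `2 ^ K`: its left
derivative at `1` is infinite, while it is smooth at `1 / 2`. -/
lemma not_multiplicative_bifractionalProfile_of_lt_one {a K p : ℝ} (hK0 : 0 < K) (hp0 : 0 < p)
    (hp1 : p < 1)
    (h : ∀ s t, 0 < s → s ≤ 1 → 0 < t → t ≤ 1 → bifractionalProfile a K p (s * t) * 2 ^ K =
      bifractionalProfile a K p s * bifractionalProfile a K p t) : False := by
  have hpos : 0 < bifractionalProfile a K p (1 / 2) := by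
    have h1 : (1 : ℝ) < (1 + (1 / 2 : ℝ) ^ a) ^ K :=
      Real.one_lt_rpow (by linarith [Real.rpow_pos_of_pos (one_half_pos (α := ℝ)) a]) hK0
    have h2 : (1 - 1 / 2 : ℝ) ^ p < 1 := Real.rpow_lt_one (by norm_num) (by norm_num) hp0
    unfold bifractionalProfile
    linarith
  obtain ⟨D, hD⟩ : ∃ D, HasDerivAt (bifractionalProfile a K p) D (1 / 2 * 1) :=
    ⟨_, hasDerivAt_bifractionalProfile (by norm_num) (Or.inl (by norm_num))
      (Or.inl (by norm_num))⟩
  have h1 : HasDerivAt (fun t => (bifractionalProfile a K p (1 / 2 * t)) * 2 ^ K /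
      bifractionalProfile a K p (1 / 2)) _ 1 :=
    ((hD.comp (1 : ℝ) ((hasDerivAt_id (1 : ℝ)).const_mul (1 / 2))).mul_const
      ((2 : ℝ) ^ K)).div_const (bifractionalProfile a K p (1 / 2))
  have h2 := (hasDerivAt_one_add_rpow_rpow (a := a) (K := K) zero_le_one
    (Or.inl one_ne_zero)).sub h1
  refine not_hasDerivWithinAt_one_sub_rpow hp0 hp1
    (h2.hasDerivWithinAt.congr_of_eventuallyEq_of_mem ?_ Set.self_mem_Iic)
  have hmem : Set.Ioi (0 : ℝ) ∈ nhdsWithin 1 (Set.Iic 1) :=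
    mem_nhdsWithin_of_mem_nhds (Ioi_mem_nhds one_pos)
  filter_upwards [hmem, self_mem_nhdsWithin] with t ht0 ht1
  simp only [Pi.sub_apply]
  rw [h _ t one_half_pos (by norm_num) ht0 ht1, mul_div_cancel_left₀ _ hpos.ne']
  simp [bifractionalProfile]

/-- If the profile is multiplicative up to the normalization `2 ^ K` and `1 < a`, then it is linear
on `(0, 1]`. -/
lemma bifractionalProfile_eq_of_multiplicative {a K p : ℝ} (hp : 0 < p) (ha : 1 < a)
    (h : ∀ s t, 0 < s → s ≤ 1 → 0 < t → t ≤ 1 → bifractionalProfile a K p (s * t) * 2 ^ K =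
      bifractionalProfile a K p s * bifractionalProfile a K p t)
    {s : ℝ} (hs0 : 0 < s) (hs1 : s ≤ 1) : bifractionalProfile a K p s = 2 ^ K * s := by
  have hD : HasDerivAt (bifractionalProfile a K p) p 0 := by
    simpa [Real.zero_rpow (sub_pos.2 ha).ne'] using
      hasDerivAt_bifractionalProfile (a := a) (K := K) (p := p) le_rfl (Or.inr ha.le)
        (Or.inl (by norm_num))
  have hD' : HasDerivAt (bifractionalProfile a K p) p (s * 0) := by simpa using hD
  have h1 : HasDerivWithinAt (fun t => bifractionalProfile a K p (s * t) * 2 ^ K)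
      (p * (s * 1) * 2 ^ K) (Set.Icc 0 1) 0 :=
    ((hD'.comp (0 : ℝ) ((hasDerivAt_id (0 : ℝ)).const_mul s)).mul_const
      ((2 : ℝ) ^ K)).hasDerivWithinAt
  have h2 := (hD.const_mul (bifractionalProfile a K p s)).hasDerivWithinAt (s := Set.Icc 0 1)
  have h0 : bifractionalProfile a K p 0 = 0 := by
    simp [bifractionalProfile, Real.zero_rpow (one_pos.trans ha).ne']
  have h3 := h2.congr_of_mem (f₁ := fun t => bifractionalProfile a K p (s * t) * 2 ^ K)
    (fun t ht => by
      rcases ht.1.eq_or_lt with rfl | ht0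
      · simp [h0]
      · exact h s t hs0 hs1 ht0 ht.2) (Set.left_mem_Icc.2 zero_le_one)
  have h4 := (uniqueDiffOn_Icc (zero_lt_one' ℝ) 0 (Set.left_mem_Icc.2 zero_le_one)).eq_deriv
    _ h1 h3
  apply mul_right_cancel₀ hp.ne'
  linarith

/-- For `1 ≤ p < 2` and `1 < a` the profile is not multiplicative up to the normalization `2 ^ K`:
it would be linear, with the wrong left derivative at `1`. -/
lemma not_multiplicative_bifractionalProfile_of_one_le {a K p : ℝ} (hp1 : 1 ≤ p) (hp2 : p < 2)
    (ha : 1 < a) (hp : p = a * K)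
    (h : ∀ s t, 0 < s → s ≤ 1 → 0 < t → t ≤ 1 → bifractionalProfile a K p (s * t) * 2 ^ K =
      bifractionalProfile a K p s * bifractionalProfile a K p t) : False := by
  have hp0 : 0 < p := by linarith
  have h1 := (hasDerivAt_bifractionalProfile (a := a) (K := K) (p := p) zero_le_one
    (Or.inl one_ne_zero) (Or.inr hp1)).hasDerivWithinAt (s := Set.Icc 0 1)
  have h2 := ((hasDerivAt_id (1 : ℝ)).const_mul ((2 : ℝ) ^ K)).hasDerivWithinAt (s := Set.Icc 0 1)
  have hmem : Set.Ioi (0 : ℝ) ∈ nhdsWithin 1 (Set.Icc 0 1) :=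
    mem_nhdsWithin_of_mem_nhds (Ioi_mem_nhds one_pos)
  have h3 := h2.congr_of_eventuallyEq_of_mem (f₁ := bifractionalProfile a K p) (by
    filter_upwards [hmem, self_mem_nhdsWithin] with t ht0 ht
    exact bifractionalProfile_eq_of_multiplicative hp0 ha h ht0 ht.2)
    (Set.right_mem_Icc.2 zero_le_one)
  have h4 := (uniqueDiffOn_Icc (zero_lt_one' ℝ) 1 (Set.right_mem_Icc.2 zero_le_one)).eq_deriv
    _ h1 h3
  have h2K : (2 : ℝ) ^ K = 2 * 2 ^ (K - 1) := by
    rw [Real.rpow_sub_one two_ne_zero]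
    ring
  have hpos : (0 : ℝ) < 2 ^ (K - 1) := by positivity
  simp only [Real.one_rpow, one_add_one_eq_two, mul_one, sub_self, ← hp, h2K] at h4
  rcases hp1.eq_or_lt with rfl | hp1
  · have h5 : (2 : ℝ) ^ (K - 1) = 1 := by
      simp at h4
      linarith
    have hK : K - 1 < 0 := by nlinarith
    exact (Real.rpow_lt_one_of_one_lt_of_neg one_lt_two hK).ne h5
  · rw [Real.zero_rpow (sub_pos.2 hp1).ne'] at h4
    nlinarith

/-- Bi-fractional Brownian motion with parameters `H̃ ∈ (0,1)`, `K̃ ∈ (0,1]`,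
`(H̃,K̃) ≠ (1/2,1)`, is not Markov: its covariance fails Doob's criterion. -/
theorem bifractional_not_markov (H K : ℝ)
    (hH0 : 0 < H) (hH1 : H < 1) (hK0 : 0 < K) (hK1 : K ≤ 1)
    (hHK : ¬ (H = 1/2 ∧ K = 1))
    (R : ℝ → ℝ → ℝ)
    (hR : ∀ s t : ℝ, 0 ≤ s → 0 ≤ t → R s t =
      2 ^ (-K) * ((s ^ (2 * H) + t ^ (2 * H)) ^ K - |s - t| ^ (2 * H * K))) :
    ∃ s t u : ℝ, 0 < s ∧ s ≤ t ∧ t ≤ u ∧ R s u * R t t ≠ R s t * R t u := by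
  by_contra! hM
  have hp0 : 0 < 2 * H * K := by positivity
  have hp2 : 2 * H * K < 2 := by nlinarith
  have hRφ : ∀ s t : ℝ, 0 < s → s ≤ 1 → 0 < t → R (s * t) t =
      2 ^ (-K) * (t ^ (2 * H * K) * bifractionalProfile (2 * H) K (2 * H * K) s) := by
    intro s t hs0 hs1 ht
    have e1 : (s * t) ^ (2 * H) + t ^ (2 * H) = t ^ (2 * H) * (1 + s ^ (2 * H)) := by
      rw [Real.mul_rpow hs0.le ht.le]
      ring
    have e2 : |s * t - t| = t * (1 - s) := by
      rw [abs_sub_comm, abs_of_nonneg (by nlinarith)]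
      ring
    rw [hR _ _ (by positivity) ht.le, e1, e2, Real.mul_rpow (by positivity) (by positivity),
      Real.mul_rpow ht.le (sub_nonneg.2 hs1), ← Real.rpow_mul ht.le, bifractionalProfile]
    ring
  have hmul : ∀ s t, 0 < s → s ≤ 1 → 0 < t → t ≤ 1 →
      bifractionalProfile (2 * H) K (2 * H * K) (s * t) * 2 ^ K =
      bifractionalProfile (2 * H) K (2 * H * K) s *
        bifractionalProfile (2 * H) K (2 * H * K) t := by
    intro s t hs0 hs1 ht0 ht1
    have hst : s * t ≤ t := by nlinarith
    have h1 := hM (s * t) t 1 (by positivity) hst ht1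
    have r1 := hRφ (s * t) 1 (by positivity) (hst.trans ht1) one_pos
    have r2 := hRφ 1 t one_pos le_rfl ht0
    have r3 := hRφ t 1 ht0 ht1 one_pos
    rw [mul_one, Real.one_rpow, one_mul] at r1 r3
    rw [one_mul, bifractionalProfile_one hp0] at r2
    rw [r1, r2, r3, hRφ s t hs0 hs1 ht0] at h1
    have hc : (2 : ℝ) ^ (-K) * 2 ^ (-K) * t ^ (2 * H * K) ≠ 0 := by positivity
    apply mul_left_cancel₀ hc
    linear_combination h1
  rcases lt_or_ge (2 * H * K) 1 with hp1 | hp1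
  · exact not_multiplicative_bifractionalProfile_of_lt_one hK0 hp0 hp1 hmul
  · refine not_multiplicative_bifractionalProfile_of_one_le hp1 hp2 ?_ rfl hmul
    by_contra! ha
    have hK : K = 1 := by nlinarith
    subst hK
    exact hHK ⟨by linarith, rfl⟩
end

section
/- Let β > 0 and let G : (0,∞) → ℝ be continuously differentiable with lim_{x→∞} |G(x)|·x^{−ε} = 0 and lim_{x→∞} |x·G'(x)|·x^{−ε} = 0 for every ε > 0. Set g(x) = G(1/(1−x)) for x ∈ [0,1) and F(x) = (1−x)^β · g(x). Then lim_{t→∞} t · ∫₀¹ F(s)·( F(s) − F((1 − 1/t)·s) ) ds = −(1/2) · ∫₀¹ F(s)² ds. -/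
open Real Filter MeasureTheory intervalIntegral

/-- A function that is continuous on `[1, ∞)` and `o(x ^ ε)` at infinity is bounded by a multiple
of `x ^ ε` on all of `[1, ∞)`. -/
lemma exists_abs_le_mul_rpow {h : ℝ → ℝ} {ε : ℝ} (hε : 0 ≤ ε) (hc : ContinuousOn h (Set.Ici 1))
    (ht : Tendsto (fun x : ℝ => |h x| * x ^ (-ε)) atTop (nhds 0)) :
    ∃ C : ℝ, 0 ≤ C ∧ ∀ x : ℝ, 1 ≤ x → |h x| ≤ C * x ^ ε := by
  obtain ⟨X, hX⟩ := eventually_atTop.1 (ht.eventually (gt_mem_nhds zero_lt_one))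
  obtain ⟨M, hM⟩ := (isCompact_Icc (a := (1 : ℝ)) (b := X)).exists_bound_of_continuousOn
    (hc.mono Set.Icc_subset_Ici_self)
  refine ⟨max M 1, le_max_of_le_right zero_le_one, fun x hx => ?_⟩
  have hxp : 0 < x ^ ε := rpow_pos_of_pos (by linarith) _
  rcases le_total x X with h1 | h1
  · calc |h x| ≤ max M 1 := (hM x ⟨hx, h1⟩).trans (le_max_left _ _)
      _ ≤ max M 1 * x ^ ε :=
        le_mul_of_one_le_right (le_max_of_le_right zero_le_one) (one_le_rpow hx hε)
  · have h2 := hX x h1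
    rw [rpow_neg (by linarith), ← div_eq_mul_inv, div_lt_one hxp] at h2
    exact h2.le.trans (le_mul_of_one_le_left hxp.le (le_max_right _ _))

lemma intervalIntegrable_one_sub_rpow {r : ℝ} (hr : -1 < r) :
    IntervalIntegrable (fun s : ℝ => (1 - s) ^ r) volume 0 1 := by
  simpa using ((intervalIntegrable_rpow' (a := 0) (b := 1) hr).comp_sub_left 1).symm

/-- If `K` is differentiable on `(-∞, 1)` with `|K s| ≤ A (1 - s) ^ γ` and
`|K' s| ≤ B (1 - s) ^ (γ - 1)` on `[0, 1)`, then
`t ∫₀¹ K(s) (K(s) - K((1 - 1/t) s)) ds → -(1/2) ∫₀¹ K(s)² ds`. -/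
lemma tendsto_mul_integral_mul_sub {K : ℝ → ℝ} {γ A B : ℝ} (hγ : 0 < γ) (hγ1 : γ ≤ 1)
    (hA : 0 ≤ A) (hB : 0 ≤ B) (hd : ∀ s < 1, DifferentiableAt ℝ K s)
    (hK : ∀ s : ℝ, 0 ≤ s → s < 1 → |K s| ≤ A * (1 - s) ^ γ)
    (hK' : ∀ s : ℝ, 0 ≤ s → s < 1 → |deriv K s| ≤ B * (1 - s) ^ (γ - 1)) :
    Tendsto (fun t : ℝ => t * ∫ s in (0:ℝ)..1, K s * (K s - K ((1 - 1/t) * s)))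
      atTop (nhds (-(1/2) * ∫ s in (0:ℝ)..1, (K s) ^ 2)) := by
  have hcont : ContinuousOn K (Set.Iio 1) := fun s hs => (hd s hs).continuousAt.continuousWithinAt
  have hmeasK : AEStronglyMeasurable K (volume.restrict (Set.Ioo 0 1)) :=
    (hcont.mono fun s hs => hs.2).aestronglyMeasurable measurableSet_Ioo
  have hmeasK' : AEStronglyMeasurable (deriv K) (volume.restrict (Set.Ioo 0 1)) :=
    (measurable_deriv K).aestronglyMeasurable
  have hrestrict : volume.restrict (Set.uIoc (0 : ℝ) 1) = volume.restrict (Set.Ioo 0 1) := by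
    rw [Set.uIoc_of_le zero_le_one, restrict_Ioo_eq_restrict_Ioc]
  have hae : ∀ p : ℝ → Prop, (∀ s, 0 < s → s < 1 → p s) →
      ∀ᵐ s ∂volume, s ∈ Set.uIoc (0 : ℝ) 1 → p s := by
    intro p hp
    rw [← ae_restrict_iff' measurableSet_uIoc, hrestrict, ae_restrict_iff' measurableSet_Ioo]
    exact Eventually.of_forall fun s hs => hp s hs.1 hs.2
  have hKA : ∀ s : ℝ, 0 ≤ s → s < 1 → |K s| ≤ A := fun s h0 h1 =>
    (hK s h0 h1).trans (mul_le_of_le_one_right hA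
      (rpow_le_one (by linarith) (by linarith) hγ.le))
  have hbound : IntervalIntegrable (fun s : ℝ => A * (B * (1 - s) ^ (γ - 1))) volume 0 1 :=
    ((intervalIntegrable_one_sub_rpow (by linarith)).const_mul B).const_mul A
  have hlip : ∀ s : ℝ, 0 ≤ s → s < 1 → ∀ t : ℝ, 1 ≤ t →
      |t * (K s - K ((1 - 1/t) * s))| ≤ B * (1 - s) ^ (γ - 1) := by
    intro s h0 h1 t ht
    have ht0 : 0 < t := by linarith
    have hit : 1 / t ≤ 1 := by rw [div_le_one ht0]; exact ht
    have hit0 : 0 < 1 / t := by positivity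
    have hmem : (1 - 1/t) * s ∈ Set.Icc 0 s :=
      ⟨mul_nonneg (by linarith) h0, mul_le_of_le_one_left h0 (by linarith)⟩
    have hmv := (convex_Icc (0 : ℝ) s).norm_image_sub_le_of_norm_deriv_le (f := K)
      (C := B * (1 - s) ^ (γ - 1)) (fun x hx => hd x (by linarith [hx.2])) (fun x hx => by
        refine (hK' x hx.1 (by linarith [hx.2])).trans (mul_le_mul_of_nonneg_left ?_ hB)
        exact rpow_le_rpow_of_nonpos (by linarith) (by linarith [hx.2]) (by linarith))
      hmem (Set.right_mem_Icc.2 h0)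
    have hnn : 0 ≤ B * (1 - s) ^ (γ - 1) := mul_nonneg hB (rpow_nonneg (by linarith) _)
    have hdist : s - (1 - 1/t) * s = s / t := by ring
    rw [norm_eq_abs, norm_eq_abs, hdist, abs_of_nonneg (div_nonneg h0 ht0.le)] at hmv
    rw [abs_mul, abs_of_pos ht0]
    calc t * |K s - K ((1 - 1/t) * s)| ≤ t * (B * (1 - s) ^ (γ - 1) * (s / t)) := by gcongr
      _ = B * (1 - s) ^ (γ - 1) * s := by field_simp
      _ ≤ B * (1 - s) ^ (γ - 1) := mul_le_of_le_one_right hnn h1.le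
  have hpt : ∀ s < 1, Tendsto (fun t : ℝ => t * (K s * (K s - K ((1 - 1/t) * s)))) atTop
      (nhds (K s * (s * deriv K s))) := by
    intro s hs
    have hin : HasDerivAt (fun h : ℝ => (1 - h) * s) (-s) 0 := by
      simpa using ((hasDerivAt_id (0 : ℝ)).const_sub 1).mul_const s
    have hout : HasDerivAt K (deriv K s) ((1 - 0) * s) := by
      simpa using (hd s hs).hasDerivAt
    have hlim := ((hout.comp (0 : ℝ) hin).tendsto_slope_zero_right.comp
      tendsto_inv_atTop_nhdsGT_zero).const_mul (-K s)
    convert hlim using 2 with t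
    · simp
      ring
    · ring
  have hdct : Tendsto (fun t : ℝ => ∫ s in (0:ℝ)..1, t * (K s * (K s - K ((1 - 1/t) * s))))
      atTop (nhds (∫ s in (0:ℝ)..1, K s * (s * deriv K s))) := by
    refine tendsto_integral_filter_of_dominated_convergence
      (fun s : ℝ => A * (B * (1 - s) ^ (γ - 1))) ?_ ?_ hbound
      (hae _ fun s _ h1 => hpt s h1)
    · filter_upwards [eventually_ge_atTop 1] with t ht
      rw [hrestrict]
      have hit0 : 0 < 1 / t := by positivity
      have hshift : ContinuousOn (fun s => K ((1 - 1/t) * s)) (Set.Ioo 0 1) :=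
        hcont.comp (by fun_prop) fun s hs => by
          simp only [Set.mem_Iio]
          nlinarith [hs.1, hs.2]
      exact (hmeasK.mul (hmeasK.sub
        (hshift.aestronglyMeasurable measurableSet_Ioo))).const_mul t
    · filter_upwards [eventually_ge_atTop 1] with t ht
      refine hae _ fun s h0 h1 => ?_
      rw [mul_left_comm, norm_mul]
      exact mul_le_mul (hKA s h0.le h1) (hlip s h0.le h1 t ht) (norm_nonneg _) hA
  have hint1 : IntervalIntegrable (fun s => K s * (s * deriv K s)) volume 0 1 := by
    refine hbound.mono_fun' ?_ ?_
    · rw [hrestrict]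
      exact hmeasK.mul (aestronglyMeasurable_id.mul hmeasK')
    · refine (ae_restrict_iff' measurableSet_uIoc).2 (hae _ fun s h0 h1 => ?_)
      simp only [norm_mul, norm_eq_abs]
      refine mul_le_mul (hKA s h0.le h1) ?_ (by positivity) hA
      rw [abs_of_pos h0]
      exact (mul_le_of_le_one_left (abs_nonneg _) h1.le).trans (hK' s h0.le h1)
  have hint2 : IntervalIntegrable (fun s => K s ^ 2) volume 0 1 := by
    refine (intervalIntegrable_const (c := A ^ 2)).mono_fun' ?_ ?_
    · rw [hrestrict]
      exact hmeasK.pow 2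
    · refine (ae_restrict_iff' measurableSet_uIoc).2 (hae _ fun s h0 h1 => ?_)
      simp only [norm_pow]
      exact pow_le_pow_left₀ (norm_nonneg _) (hKA s h0.le h1) 2
  have hK1 : Tendsto K (nhdsWithin 1 (Set.Iio 1)) (nhds 0) := by
    have hz : Tendsto (fun s : ℝ => A * (1 - s) ^ γ) (nhdsWithin 1 (Set.Iio 1)) (nhds 0) := by
      have hc : Continuous (fun s : ℝ => A * (1 - s) ^ γ) :=
        continuous_const.mul ((continuous_const.sub continuous_id).rpow_const
          fun _ => Or.inr hγ.le)
      simpa [zero_rpow hγ.ne'] using (hc.tendsto 1).mono_left nhdsWithin_le_nhds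
    refine squeeze_zero_norm' ?_ hz
    filter_upwards [Ioo_mem_nhdsLT (zero_lt_one (α := ℝ))] with s hs
    exact hK s hs.1.le hs.2
  have hparts : ∫ s in (0:ℝ)..1, (K s ^ 2 + 2 * (K s * (s * deriv K s))) = 0 - 0 := by
    refine integral_eq_sub_of_hasDerivAt_of_tendsto (f := fun s => s * K s ^ 2) zero_lt_one
      (fun s hs => ?_) (hint2.add (hint1.const_mul 2)) ?_ ?_
    · refine ((hasDerivAt_id s).mul ((hd s hs.2).hasDerivAt.pow 2)).congr_deriv ?_
      simp
      ring
    · have hc : ContinuousAt (fun s => s * K s ^ 2) 0 :=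
        continuousAt_id.mul ((hd 0 zero_lt_one).continuousAt.pow 2)
      simpa using hc.tendsto.mono_left nhdsWithin_le_nhds
    · simpa using (tendsto_id.mono_left nhdsWithin_le_nhds).mul (hK1.pow 2)
  rw [intervalIntegral.integral_add hint2 (hint1.const_mul 2),
    intervalIntegral.integral_const_mul] at hparts
  have hval : -(1/2) * ∫ s in (0:ℝ)..1, K s ^ 2 = ∫ s in (0:ℝ)..1, K s * (s * deriv K s) := by
    linarith
  simpa only [hval, intervalIntegral.integral_const_mul] using hdct

/-- The derivative of the kernel `x ↦ (1 - x) ^ β * G (1 / (1 - x))`. -/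
lemma hasDerivAt_one_sub_rpow_mul_comp {β s : ℝ} {G : ℝ → ℝ} (hs : s < 1)
    (hG : DifferentiableAt ℝ G (1 / (1 - s))) :
    HasDerivAt (fun x : ℝ => (1 - x) ^ β * G (1 / (1 - x)))
      ((1 - s) ^ (β - 1) * (1 / (1 - s) * deriv G (1 / (1 - s)) - β * G (1 / (1 - s)))) s := by
  have hpos : 0 < 1 - s := by linarith
  have hsub : HasDerivAt (fun x : ℝ => 1 - x) (-1) s := by
    simpa using (hasDerivAt_id s).const_sub 1
  have hinv : HasDerivAt (fun x : ℝ => 1 / (1 - x)) (1 / (1 - s) ^ 2) s := by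
    simpa [Pi.inv_def] using hsub.inv hpos.ne'
  refine ((hsub.rpow_const (p := β) (Or.inl hpos.ne')).mul
    (hG.hasDerivAt.comp s hinv)).congr_deriv ?_
  rw [rpow_sub_one hpos.ne']
  simp only [Function.comp]
  field_simp
  ring

/-- For `F(x) = (1−x)^β g(x)` with `g(x) = G(1/(1−x))`, `g ∈ 𝒢`:
`t ∫₀¹ F(s)(F(s) − F((1−1/t)s)) ds → −(1/2) ∫₀¹ F(s)² ds` as `t → ∞`. -/
theorem limit_F_difference (β : ℝ) (hβ : 0 < β) (G : ℝ → ℝ)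
    (hG : ContDiffOn ℝ 1 G (Set.Ioi 0))
    (hGgrowth : ∀ ε : ℝ, 0 < ε →
      Tendsto (fun x : ℝ => |G x| * x ^ (-ε)) atTop (nhds 0))
    (hG'growth : ∀ ε : ℝ, 0 < ε →
      Tendsto (fun x : ℝ => |x * deriv G x| * x ^ (-ε)) atTop (nhds 0))
    (F : ℝ → ℝ)
    (hF : ∀ x : ℝ, 0 ≤ x → x < 1 → F x = (1 - x) ^ β * G (1 / (1 - x))) :
    Tendsto (fun t : ℝ => t * ∫ s in (0:ℝ)..1, F s * (F s - F ((1 - 1/t) * s)))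
      atTop (nhds (-(1/2) * ∫ s in (0:ℝ)..1, (F s) ^ 2)) := by
  obtain ⟨γ, hγ, hγβ, hγ1⟩ : ∃ γ : ℝ, 0 < γ ∧ γ < β ∧ γ ≤ 1 :=
    ⟨min (β / 2) 1, by positivity, (min_le_left _ _).trans_lt (by linarith), min_le_right _ _⟩
  have hε : 0 < β - γ := by linarith
  have hsub : Set.Ici (1 : ℝ) ⊆ Set.Ioi 0 := Set.Ici_subset_Ioi.2 zero_lt_one
  have hG' : ContinuousOn (deriv G) (Set.Ioi 0) := hG.continuousOn_deriv_of_isOpen isOpen_Ioi le_rfl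
  obtain ⟨A, hA, hGA⟩ := exists_abs_le_mul_rpow hε.le (hG.continuousOn.mono hsub)
    (hGgrowth _ hε)
  obtain ⟨B, hB, hGB⟩ := exists_abs_le_mul_rpow (h := fun x => x * deriv G x) hε.le
    (continuousOn_id.mul (hG'.mono hsub)) (hG'growth _ hε)
  have hone : ∀ s : ℝ, 0 ≤ s → s < 1 → 1 ≤ 1 / (1 - s) := fun s h0 h1 =>
    (one_le_div (by linarith)).2 (by linarith)
  have hpow : ∀ s : ℝ, s < 1 → ∀ b : ℝ,
      (1 - s) ^ b * (1 / (1 - s)) ^ (β - γ) = (1 - s) ^ (b - (β - γ)) := fun s h1 b => by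
    rw [one_div, inv_rpow (by linarith), ← div_eq_mul_inv, ← rpow_sub (by linarith)]
  have hder : ∀ s : ℝ, s < 1 → _ := fun s hs => hasDerivAt_one_sub_rpow_mul_comp (β := β) (G := G) hs
    ((hG.differentiableOn one_ne_zero).differentiableAt
      (Ioi_mem_nhds (one_div_pos.2 (by linarith))))
  have key := tendsto_mul_integral_mul_sub (K := fun x : ℝ => (1 - x) ^ β * G (1 / (1 - x)))
    (A := A) (B := B + β * A) hγ hγ1 hA (by positivity)
    (fun s hs => (hder s hs).differentiableAt)
    (fun s h0 h1 => by
      have hp : 0 ≤ (1 - s) ^ β := rpow_nonneg (by linarith) _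
      rw [abs_mul, abs_of_nonneg hp]
      calc (1 - s) ^ β * |G (1 / (1 - s))|
          ≤ (1 - s) ^ β * (A * (1 / (1 - s)) ^ (β - γ)) := by
            gcongr
            exact hGA _ (hone s h0 h1)
        _ = A * (1 - s) ^ γ := by
            rw [mul_left_comm, hpow s h1, sub_sub_cancel])
    (fun s h0 h1 => by
      have hp : 0 ≤ (1 - s) ^ (β - 1) := rpow_nonneg (by linarith) _
      rw [(hder s h1).deriv, abs_mul, abs_of_nonneg hp]
      calc (1 - s) ^ (β - 1) * |1 / (1 - s) * deriv G (1 / (1 - s)) - β * G (1 / (1 - s))|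
          ≤ (1 - s) ^ (β - 1) *
              (B * (1 / (1 - s)) ^ (β - γ) + β * (A * (1 / (1 - s)) ^ (β - γ))) := by
            gcongr
            refine (abs_sub _ _).trans (add_le_add (hGB _ (hone s h0 h1)) ?_)
            rw [abs_mul, abs_of_pos hβ]
            gcongr
            exact hGA _ (hone s h0 h1)
        _ = (B + β * A) * ((1 - s) ^ (β - 1) * (1 / (1 - s)) ^ (β - γ)) := by ring
        _ = (B + β * A) * (1 - s) ^ (γ - 1) := by
            rw [hpow s h1, show β - 1 - (β - γ) = γ - 1 by ring])
  have hcongr : ∀ u v : ℝ → ℝ, Set.EqOn u v (Set.Ioo 0 1) →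
      ∫ s in (0:ℝ)..1, u s = ∫ s in (0:ℝ)..1, v s := fun u v huv => by
    simp only [integral_of_le zero_le_one, integral_Ioc_eq_integral_Ioo]
    exact setIntegral_congr_fun measurableSet_Ioo huv
  rw [hcongr (fun s => F s ^ 2) (fun s => ((1 - s) ^ β * G (1 / (1 - s))) ^ 2) fun s hs => by
    simp only [hF s hs.1.le hs.2]]
  refine key.congr' ?_
  filter_upwards [eventually_ge_atTop 1] with t ht
  congr 1
  refine hcongr _ _ fun s hs => ?_
  have hit : 1 / t ≤ 1 := (div_le_one (by linarith)).2 ht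
  have hit0 : 0 < 1 / t := by positivity
  have hlt : (1 - 1 / t) * s < 1 := by nlinarith [hs.1, hs.2]
  simp only [hF s hs.1.le hs.2, hF _ (mul_nonneg (sub_nonneg.2 hit) hs.1.le) hlt]
end

section
/- For every H ∈ (0,1), the inequality H·(1 − 2H) / (2 − 2^{2H−1}) < 1/2 holds (in particular the left-hand side never equals 1). -/
open Real

/-- The chord bound for the convex function `2 ^ (2 * H - 1)` on `[0, 1]`. -/
theorem two_rpow_two_mul_sub_one_le {H : ℝ} (hH0 : 0 ≤ H) (hH1 : H ≤ 1) :
    (2 : ℝ) ^ (2 * H - 1) ≤ (1 + 3 * H) / 2 := by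
  have hbern : (1 + 3 : ℝ) ^ H ≤ 1 + H * 3 :=
    rpow_one_add_le_one_add_mul_self (by norm_num) hH0 hH1
  have hpow : (2 : ℝ) ^ (2 * H - 1) = (1 + 3 : ℝ) ^ H / 2 := by
    rw [Real.rpow_sub two_pos, Real.rpow_mul zero_le_two]
    norm_num
  rw [hpow, mul_comm 3 H]
  gcongr

/-- For every `H ∈ (0,1)`, `H(1 − 2H)/(2 − 2^{2H−1}) < 1/2`. -/
theorem subfractional_coefficient_lt_half (H : ℝ) (hH0 : 0 < H) (hH1 : H < 1) :
    H * (1 - 2 * H) / (2 - (2 : ℝ) ^ (2 * H - 1)) < 1/2 := by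
  have hchord := two_rpow_two_mul_sub_one_le hH0.le hH1.le
  rw [div_lt_iff₀ (by linarith)]
  nlinarith [sq_nonneg (H - 7 / 16)]
end
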